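/- Let A : Diff_id^1(ℝ³) → 𝓛(V,V*), φ ↦ A_φ, assign to each φ a bounded symmetric nonnegative operator, with φ ↦ A_φ locally Lipschitz for the ‖·‖_{1,∞} distance. Let Θ ⊂ ℝᵐ and let j : Diff_id^1(ℝ³) × Θ → V*. Fix θ ∈ Θ and suppose φ ↦ j(φ,θ) is locally Lipschitz for the ‖·‖_{1,∞} distance and bounded in V*-norm (sup_φ ‖j(φ,θ)‖_{V*} < ∞). Then for every T > 0 the system φ(t) = id + ∫₀ᵗ v(s) ∘ φ(s) ds with v(s) = (ω K_V⁻¹ + A_{φ(s)})⁻¹ j(φ(s),θ) has a unique solution on [0,T], and this solution is a continuous map from [0,T] into Diff_id²(ℝ³). -/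

import Mathlib

open MeasureTheory Filter Set
open scoped RealInnerProductSpace Topology

noncomputable section

/-- Euclidean 3-space. -/
abbrev E3 : Type := EuclideanSpace ℝ (Fin 3)

/-- The supremum over `ℝ³` of the norm of the `k`-th derivative of `v`. -/
def supDeriv (k : ℕ) (v : E3 → E3) : ℝ := ⨆ x : E3, ‖iteratedFDeriv ℝ k v x‖

/-- The norm `‖v‖_{s,∞} = Σ_{k ≤ s} sup_x |Dᵏ v(x)|`. -/
def normS (s : ℕ) (v : E3 → E3) : ℝ := ∑ k ∈ Finset.range (s + 1), supDeriv k v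

/-- The seminorm `‖v‖_{1,∞}^Ω = sup_{x ∈ Ω} |v(x)| + sup_{x ∈ Ω} |Dv(x)|`. -/
def normSOn (Ω : Set E3) (v : E3 → E3) : ℝ :=
  (⨆ x : Ω, ‖v (x : E3)‖) + ⨆ x : Ω, ‖fderiv ℝ v (x : E3)‖

/-- Membership in `C₀^s(ℝ³,ℝ³)`: `v` is `C^s` and all derivatives up to order `s`
tend to `0` at infinity. -/
def MemC0 (s : ℕ) (v : E3 → E3) : Prop :=
  ContDiff ℝ s v ∧
    ∀ k ≤ s, Tendsto (fun x => ‖iteratedFDeriv ℝ k v x‖) (cocompact E3) (𝓝 0)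

/-- `Diff_id^s(ℝ³)`: `C^s`-diffeomorphisms of `ℝ³` equal to the identity at infinity. -/
structure DiffId (s : ℕ) : Type where
  toFun : E3 → E3
  invFun : E3 → E3
  left_inv : Function.LeftInverse invFun toFun
  right_inv : Function.RightInverse invFun toFun
  memC0 : MemC0 s fun x => toFun x - x
  memC0_inv : MemC0 s fun x => invFun x - x

instance (s : ℕ) : CoeFun (DiffId s) fun _ => E3 → E3 := ⟨DiffId.toFun⟩

/-- The distance `‖φ − ψ‖_{s,∞}` on `Diff_id^s(ℝ³)`. -/
def distS (s : ℕ) (φ ψ : DiffId s) : ℝ := normS s fun x => φ x - ψ x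

/-- The set `𝔖_γ = {φ : ‖φ − id‖_{1,∞} ≤ γ and ‖φ⁻¹ − id‖_{1,∞} ≤ γ}`. -/
def Sgamma (γ : ℝ) : Set (DiffId 1) :=
  {φ | normS 1 (fun x => φ x - x) ≤ γ ∧ normS 1 (fun x => φ.invFun x - x) ≤ γ}

/-- `v` is the velocity `(ω K_V⁻¹ + B)⁻¹ j`, i.e. the unique minimizer of
`(ω/2)‖·‖² + (1/2)(B · | ·) − (j | ·)`:  `ω⟪v,w⟫ + (Bv|w) = (j|w)` for all `w`. -/
def IsVel {V : Type*} [NormedAddCommGroup V] [InnerProductSpace ℝ V]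
    (B : V →L[ℝ] V →L[ℝ] ℝ) (ω : ℝ) (j : V →L[ℝ] ℝ) (v : V) : Prop :=
  ∀ w : V, ω * ⟪v, w⟫ + B v w = j w

/-- `(φ, v)` solves the control system
`φ(t) = id + ∫₀ᵗ v(s) ∘ φ(s) ds`, `v(s) = (ω K_V⁻¹ + A_{φ(s)})⁻¹ j(s)` on `[0,T₀]`,
with `t ↦ φ(t)` continuous into `Diff_id¹(ℝ³)`. -/
def IsSolution {V : Type*} [NormedAddCommGroup V] [InnerProductSpace ℝ V]
    (emb : V →ₗ[ℝ] (E3 → E3)) (ω : ℝ) (A : DiffId 1 → V →L[ℝ] V →L[ℝ] ℝ)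
    (j : ℝ → V →L[ℝ] ℝ) (T₀ : ℝ) (φ : ℝ → DiffId 1) (v : ℝ → V) : Prop :=
  (∀ t ∈ Icc (0 : ℝ) T₀, IsVel (A (φ t)) ω (j t) (v t)) ∧
  (∀ t ∈ Icc (0 : ℝ) T₀, ∀ x : E3,
    IntervalIntegrable (fun s => emb (v s) (φ s x)) volume 0 t ∧
      φ t x = x + ∫ s in (0 : ℝ)..t, emb (v s) (φ s x)) ∧
  ∀ t₀ ∈ Icc (0 : ℝ) T₀,
    Tendsto (fun t => distS 1 (φ t) (φ t₀)) (𝓝[Icc (0 : ℝ) T₀] t₀) (𝓝 0)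

/-- `(φ, v)` solves the parametric-yank system
`φ(t) = id + ∫₀ᵗ v(s) ∘ φ(s) ds`, `v(s) = (ω K_V⁻¹ + A_{φ(s)})⁻¹ jm(φ(s))` on `[0,T₀]`. -/
def IsSolutionP {V : Type*} [NormedAddCommGroup V] [InnerProductSpace ℝ V]
    (emb : V →ₗ[ℝ] (E3 → E3)) (ω : ℝ) (A : DiffId 1 → V →L[ℝ] V →L[ℝ] ℝ)
    (jm : DiffId 1 → V →L[ℝ] ℝ) (T₀ : ℝ) (φ : ℝ → DiffId 1) (v : ℝ → V) : Prop :=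
  (∀ t ∈ Icc (0 : ℝ) T₀, IsVel (A (φ t)) ω (jm (φ t)) (v t)) ∧
  (∀ t ∈ Icc (0 : ℝ) T₀, ∀ x : E3,
    IntervalIntegrable (fun s => emb (v s) (φ s x)) volume 0 t ∧
      φ t x = x + ∫ s in (0 : ℝ)..t, emb (v s) (φ s x)) ∧
  ∀ t₀ ∈ Icc (0 : ℝ) T₀,
    Tendsto (fun t => distS 1 (φ t) (φ t₀)) (𝓝[Icc (0 : ℝ) T₀] t₀) (𝓝 0)

/-- Solution of the ODE on `[0,τ]` staying in `U`. -/
def YkSol {X : Type*} [NormedAddCommGroup X] [NormedSpace ℝ X] (U : Set X) (F : ℝ → X → X)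
    (u : ℝ → X) (τ : ℝ) : Prop :=
  ∀ t ∈ Icc (0:ℝ) τ, u t ∈ U ∧ HasDerivWithinAt u (F t (u t)) (Icc 0 τ) t

/-- Local Lipschitz property, uniformly in time. -/
def YkLip {X : Type*} [NormedAddCommGroup X] [NormedSpace ℝ X] (U : Set X) (F : ℝ → X → X)
    (T : ℝ) : Prop :=
  ∀ x ∈ U, ∃ r > 0, ∃ K : NNReal, Metric.closedBall x r ⊆ U ∧
    ∀ t ∈ Icc (0:ℝ) T, LipschitzOnWith K (F t) (Metric.closedBall x r)

section abstractODE

variable {X : Type*} [NormedAddCommGroup X] [NormedSpace ℝ X] {U : Set X} {F : ℝ → X → X} {T : ℝ}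

theorem YkSol.cont {u : ℝ → X} {τ : ℝ} (h : YkSol U F u τ) : ContinuousOn u (Icc 0 τ) :=
  fun t ht => (h t ht).2.continuousWithinAt

theorem YkSol.right {u : ℝ → X} {τ : ℝ} (h : YkSol U F u τ) {t : ℝ} (ht : t ∈ Ico 0 τ) :
    HasDerivWithinAt u (F t (u t)) (Ici t) t :=
  (h t ⟨ht.1, ht.2.le⟩).2.mono_of_mem_nhdsWithin (Icc_mem_nhdsGE_of_mem ht)

theorem YkSol.mono {u : ℝ → X} {τ τ' : ℝ} (h : YkSol U F u τ) (hh : τ' ≤ τ) :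
    YkSol U F u τ' := fun t ht =>
  ⟨(h t ⟨ht.1, ht.2.trans hh⟩).1, (h t ⟨ht.1, ht.2.trans hh⟩).2.mono (Icc_subset_Icc_right hh)⟩

theorem yk_unique (hL : YkLip U F T) {u w : ℝ → X} {τ : ℝ} (hτ : τ ≤ T)
    (hu : YkSol U F u τ) (hw : YkSol U F w τ) (h0 : u 0 = w 0) :
    ∀ t ∈ Icc (0:ℝ) τ, u t = w t := by
  have hcl : IsClosed ({t | u t = w t} ∩ Icc 0 τ) := by
    have h1 : ContinuousOn (fun t => u t - w t) (Icc 0 τ) := hu.cont.sub hw.cont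
    have := h1.preimage_isClosed_of_isClosed isClosed_Icc (isClosed_singleton (x := (0:X)))
    convert this using 1
    ext t
    simp [sub_eq_zero, and_comm]
  apply hcl.Icc_subset_of_forall_mem_nhdsWithin h0
  rintro x ⟨hx, hxI⟩
  have hx' : x ∈ Icc 0 τ := ⟨hxI.1, hxI.2.le⟩
  obtain ⟨r, hr, K, hball, hlip⟩ := hL (u x) (hu x hx').1
  have e1 : ∀ᶠ t in 𝓝[≥] x, u t ∈ Metric.closedBall (u x) r :=
    (hu.right hxI).continuousWithinAt (Metric.closedBall_mem_nhds _ hr)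
  have e2 : ∀ᶠ t in 𝓝[≥] x, w t ∈ Metric.closedBall (u x) r := by
    have : u x = w x := hx
    rw [this]
    exact (hw.right hxI).continuousWithinAt (Metric.closedBall_mem_nhds _ hr)
  have e3 : ∀ᶠ t in 𝓝[≥] x, t ∈ Icc 0 τ := Icc_mem_nhdsGE_of_mem hxI
  obtain ⟨b, hb, hsub⟩ := (mem_nhdsGE_iff_exists_Icc_subset).1 ((e1.and e2).and e3)
  have hb' : x < b := hb
  have key := ODE_solution_unique_of_mem_Icc_right (a := x) (b := b) (v := F) (K := K) (f := u) (g := w)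
    (s := fun _ => Metric.closedBall (u x) r)
    (fun t ht => hlip t ⟨hxI.1.trans ht.1, (ht.2.le.trans (hsub (right_mem_Icc.2 hb'.le)).2.2).trans hτ⟩)
    (hu.cont.mono fun t ht => (hsub ht).2)
    (fun t ht => hu.right ⟨hxI.1.trans ht.1, ht.2.trans_le (hsub (right_mem_Icc.2 hb'.le)).2.2⟩)
    (fun t ht => (hsub ⟨ht.1, ht.2.le⟩).1.1)
    (hw.cont.mono fun t ht => (hsub ht).2)
    (fun t ht => hw.right ⟨hxI.1.trans ht.1, ht.2.trans_le (hsub (right_mem_Icc.2 hb'.le)).2.2⟩)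
    (fun t ht => (hsub ⟨ht.1, ht.2.le⟩).1.2) hx
  filter_upwards [Icc_mem_nhdsGT hb'] with t ht using key ht

theorem yk_limit [CompleteSpace X] {g : ℝ → X} {σ a b : ℝ} (hσ : 0 < σ) (ha : 0 ≤ a) (hb : 0 ≤ b)
    {g' : ℝ → X}
    (hg : ∀ t ∈ Ico (0:ℝ) σ, HasDerivWithinAt g (g' t) (Icc 0 σ) t)
    (hbd : ∀ t ∈ Ico (0:ℝ) σ, ‖g' t‖ ≤ a + b * ‖g t‖) :
    ∃ y, Tendsto g (𝓝[<] σ) (𝓝 y) := by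
  set M := gronwallBound ‖g 0‖ b a σ with hM
  have h1 : ∀ t ∈ Ico (0:ℝ) σ, ‖g t‖ ≤ M := by
    intro t ht
    have := norm_le_gronwallBound_of_norm_deriv_right_le (f := g) (f' := g') (δ := ‖g 0‖) (K := b)
      (ε := a) (a := 0) (b := t)
      (fun s hs => ((hg s ⟨hs.1, hs.2.trans_lt ht.2⟩).continuousWithinAt).mono
        (Icc_subset_Icc_right ht.2.le))
      (fun s hs => (hg s ⟨hs.1, hs.2.trans ht.2⟩).mono_of_mem_nhdsWithin
        (Icc_mem_nhdsGE_of_mem ⟨hs.1, hs.2.trans ht.2⟩)) le_rfl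
      (fun s hs => by rw [add_comm]; exact hbd s ⟨hs.1, hs.2.trans ht.2⟩) t (right_mem_Icc.2 ht.1)
    refine this.trans ?_
    apply gronwallBound_mono (norm_nonneg _) ha hb
    linarith [ht.2]
  have hM0 : 0 ≤ M := (norm_nonneg _).trans (h1 0 ⟨le_rfl, hσ⟩)
  have hlip : LipschitzOnWith (a + b * M).toNNReal g (Ico 0 σ) := by
    apply (convex_Ico 0 σ).lipschitzOnWith_of_nnnorm_hasDerivWithin_le
      (fun t ht => (hg t ht).mono Ico_subset_Icc_self)
    intro t ht
    rw [← NNReal.coe_le_coe, coe_nnnorm, Real.coe_toNNReal _ (by positivity)]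
    refine (hbd t ht).trans ?_
    gcongr
    exact h1 t ht
  have hc : Cauchy (𝓝[<] σ) := cauchy_nhds.mono nhdsWithin_le_nhds
  have := hc.map_of_le hlip.uniformContinuousOn (le_principal_iff.2 (Ico_mem_nhdsLT hσ))
  exact CompleteSpace.complete this

theorem yk_tendsto_field (hL : YkLip U F T) (hcont : ∀ x ∈ U, ContinuousOn (fun t => F t x) (Icc 0 T))
    {l : Filter ℝ} {g : ℝ → X} {y : X} {σ : ℝ} (hy : y ∈ U) (hσ : σ ∈ Icc 0 T)
    (hl : l ≤ 𝓝[Icc 0 T] σ) (hg : Tendsto g l (𝓝 y)) :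
    Tendsto (fun t => F t (g t)) l (𝓝 (F σ y)) := by
  obtain ⟨r, hr, K, hball, hlip⟩ := hL y hy
  have h1 : Tendsto (fun t => F t y) l (𝓝 (F σ y)) := (hcont y hy σ hσ).mono_left hl
  have h2 : Tendsto (fun t => F t (g t) - F t y) l (𝓝 0) := by
    have h3 : Tendsto (fun t => (K:ℝ) * ‖g t - y‖) l (𝓝 0) := by
      have := (tendsto_iff_norm_sub_tendsto_zero.1 hg).const_mul (K:ℝ)
      simpa using this
    apply squeeze_zero_norm' _ h3
    have e : ∀ᶠ t in l, t ∈ Icc 0 T := hl self_mem_nhdsWithin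
    filter_upwards [hg (Metric.closedBall_mem_nhds _ hr), e] with t ht htI
    exact (hlip t htI).norm_sub_le ht (Metric.mem_closedBall_self hr.le)
  simpa using h2.add h1

theorem yk_exists [CompleteSpace X] (hT : 0 ≤ T) (hL : YkLip U F T)
    (hcont : ∀ x ∈ U, ContinuousOn (fun t => F t x) (Icc 0 T))
    {a b : ℝ} (ha : 0 ≤ a) (hb : 0 ≤ b)
    (hgrow : ∀ t ∈ Icc (0:ℝ) T, ∀ x ∈ U, ‖F t x‖ ≤ a + b * ‖x‖)
    {x₀ : X} (hx₀ : x₀ ∈ U)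
    (hclos : ∀ τ ∈ Ioc (0:ℝ) T, ∀ (u : ℝ → X) (y : X), u 0 = x₀ →
      (∀ t ∈ Ico (0:ℝ) τ, YkSol U F u t) → Tendsto u (𝓝[<] τ) (𝓝 y) → y ∈ U) :
    ∃ u : ℝ → X, u 0 = x₀ ∧ YkSol U F u T := by
  set S : Set ℝ := {τ | τ ∈ Icc 0 T ∧ ∃ u : ℝ → X, u 0 = x₀ ∧ YkSol U F u τ} with hS
  have h0S : (0:ℝ) ∈ S := by
    refine ⟨⟨le_rfl, hT⟩, fun _ => x₀, rfl, ?_⟩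
    intro t ht
    refine ⟨hx₀, ?_⟩
    exact HasFDerivWithinAt.of_subsingleton (by simp)
  have hbdd : BddAbove S := ⟨T, fun τ h => h.1.2⟩
  set σ := sSup S with hσdef
  have hσ0 : 0 ≤ σ := le_csSup hbdd h0S
  have hσT : σ ≤ T := csSup_le ⟨0, h0S⟩ fun τ h => h.1.2
  have hσS : σ ∈ S := by
    rcases hσ0.eq_or_lt with h | hσpos
    · rwa [← h]
    choose! w hw0 hw using fun (τ : ℝ) (h : τ ∈ S) => h.2
    have hp : ∀ t, t < σ → ∃ p ∈ S, t < p := fun t ht => exists_lt_of_lt_csSup ⟨0, h0S⟩ ht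
    choose! p hpS hpt using hp
    set g : ℝ → X := fun t => w (p t) t with hg
    have hgw : ∀ τ ∈ S, ∀ t ∈ Icc 0 τ, t < σ → g t = w τ t := by
      intro τ hτ t ht htσ
      have hm : min τ (p t) ≤ T := (min_le_left _ _).trans hτ.1.2
      exact yk_unique hL hm ((hw _ (hpS t htσ)).mono (min_le_right _ _))
        ((hw τ hτ).mono (min_le_left _ _)) (by rw [hw0 _ hτ, hw0 _ (hpS t htσ)]) t
        ⟨ht.1, le_min ht.2 (hpt t htσ).le⟩
    have hgd : ∀ t ∈ Ico (0:ℝ) σ, g t ∈ U ∧ HasDerivWithinAt g (F t (g t)) (Icc 0 σ) t := by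
      intro t ht
      have hps := hpS t ht.2
      have hpt' := hpt t ht.2
      have hsol := hw _ hps t ⟨ht.1, hpt'.le⟩
      refine ⟨hsol.1, ?_⟩
      have hmem : Icc 0 (p t) ∈ 𝓝[Icc 0 σ] t := by
        filter_upwards [self_mem_nhdsWithin, mem_nhdsWithin_of_mem_nhds (Iio_mem_nhds hpt')] with s hs hs'
        exact ⟨hs.1, le_of_lt hs'⟩
      refine (hsol.2.mono_of_mem_nhdsWithin hmem).congr_of_eventuallyEq (f₁ := g) ?_ rfl
      filter_upwards [hmem, mem_nhdsWithin_of_mem_nhds (Iio_mem_nhds ht.2)] with s hs hs'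
      exact hgw _ hps s hs hs'
    have hg0 : g 0 = x₀ := hw0 _ (hpS 0 hσpos)
    obtain ⟨y, hy⟩ := yk_limit hσpos ha hb (fun t ht => (hgd t ht).2)
      (fun t ht => hgrow t ⟨ht.1, ht.2.le.trans hσT⟩ _ (hgd t ht).1)
    have hyU : y ∈ U := hclos σ ⟨hσpos, hσT⟩ g y hg0 (fun t ht s hs =>
      ⟨(hgd s ⟨hs.1, hs.2.trans_lt ht.2⟩).1, (hgd s ⟨hs.1, hs.2.trans_lt ht.2⟩).2.mono
        (Icc_subset_Icc_right ht.2.le)⟩) hy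
    set G : ℝ → X := Function.update g σ y with hG
    have hGg : ∀ t, t ≠ σ → G t = g t := fun t ht => Function.update_of_ne ht _ _
    have hGσ : G σ = y := Function.update_self _ _ _
    have hGe : ∀ t, t ∈ Ico 0 σ → HasDerivWithinAt G (F t (g t)) (Icc 0 σ) t := by
      intro t ht
      apply (hgd t ht).2.congr_of_eventuallyEq _ (hGg t ht.2.ne)
      filter_upwards [mem_nhdsWithin_of_mem_nhds (Iio_mem_nhds ht.2)] with s hs
      exact hGg s (ne_of_lt hs)
    have hGd : ∀ t ∈ Ioo 0 σ, HasDerivAt G (F t (g t)) t := fun t ht =>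
      (hGe t ⟨ht.1.le, ht.2⟩).hasDerivAt (Icc_mem_nhds ht.1 ht.2)
    have hGt : Tendsto G (𝓝[<] σ) (𝓝 y) := by
      apply hy.congr'
      filter_upwards [self_mem_nhdsWithin] with s hs
      exact (hGg s (ne_of_lt hs)).symm
    refine ⟨⟨hσ0, hσT⟩, G, by rw [hGg _ hσpos.ne, hg0], ?_⟩
    intro t ht
    rcases ht.2.eq_or_lt with rfl | hlt
    · rw [hGσ]
      refine ⟨hyU, ?_⟩
      have : HasDerivWithinAt G (F σ y) (Iic σ) σ := by
        apply hasDerivWithinAt_Iic_of_tendsto_deriv (s := Ioo 0 σ)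
          (fun t ht => (hGd t ht).differentiableAt.differentiableWithinAt)
        · rw [ContinuousWithinAt, hGσ]
          exact hGt.mono_left (nhdsWithin_mono _ Ioo_subset_Iio_self)
        · exact Ioo_mem_nhdsLT hσpos
        · have h1 : Tendsto (fun t => F t (g t)) (𝓝[<] σ) (𝓝 (F σ y)) := by
            apply yk_tendsto_field hL hcont hyU ⟨hσ0, hσT⟩ _ hy
            rw [← nhdsWithin_Ico_eq_nhdsLT hσpos]
            exact nhdsWithin_mono _ (fun s hs => ⟨hs.1, hs.2.le.trans hσT⟩)
          apply h1.congr'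
          filter_upwards [Ioo_mem_nhdsLT hσpos] with s hs
          exact (hGd s hs).deriv.symm
      exact this.mono Icc_subset_Iic_self
    · rw [hGg _ hlt.ne]
      exact ⟨(hgd t ⟨ht.1, hlt⟩).1, hGe t ⟨ht.1, hlt⟩⟩
  rcases hσT.eq_or_lt with h | hlt
  · rw [← h]; exact hσS.2
  exfalso
  obtain ⟨u, hu0, hu⟩ := hσS.2
  have hyU := (hu σ ⟨hσ0, le_rfl⟩).1
  obtain ⟨r, hr, K, hball, hlip⟩ := hL _ hyU
  set y := u σ with hy
  set L : ℝ := a + b * (‖y‖ + r) with hLdef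
  have hL0 : 0 ≤ L := by positivity
  obtain ⟨ε, hε, hεT, hεL⟩ : ∃ ε > 0, σ + ε ≤ T ∧ L * ε ≤ r := by
    refine ⟨min (T - σ) (r / (L + 1)), lt_min (by linarith) (by positivity), ?_, ?_⟩
    · linarith [min_le_left (T - σ) (r / (L + 1))]
    · calc L * min (T - σ) (r / (L + 1)) ≤ (L + 1) * (r / (L + 1)) := by
            gcongr
            · linarith
            · exact min_le_right _ _
        _ = r := by field_simp
  have hsub : Icc σ (σ + ε) ⊆ Icc 0 T := Icc_subset_Icc hσ0 hεT
  have hPL : IsPicardLindelof F (tmin := σ) (tmax := σ + ε) ⟨σ, by simp [hε.le]⟩ y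
      ⟨r, hr.le⟩ 0 ⟨L, hL0⟩ K := by
    constructor
    · exact fun t ht => hlip t (hsub ht)
    · exact fun x hx => (hcont x (hball hx)).mono hsub
    · intro t ht x hx
      refine (hgrow t (hsub ht) x (hball hx)).trans ?_
      change a + b * ‖x‖ ≤ L
      rw [hLdef]
      gcongr
      have : ‖x - y‖ ≤ r := by rw [← dist_eq_norm]; exact hx
      calc ‖x‖ = ‖y + (x - y)‖ := by congr 1; abel
        _ ≤ ‖y‖ + ‖x - y‖ := norm_add_le _ _
        _ ≤ _ := by gcongr
    · simp [hε.le]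
      exact hεL
  obtain ⟨w, hw0, hw⟩ := hPL.exists_eq_forall_mem_Icc_hasDerivWithinAt₀
  simp only at hw0
  have hwc : ∀ᶠ t in 𝓝[≥] σ, w t ∈ Metric.closedBall y r := by
    have h1 := (hw σ ⟨le_rfl, by linarith⟩).continuousWithinAt
    rw [ContinuousWithinAt, nhdsWithin_Icc_eq_nhdsGE (by linarith), hw0] at h1
    exact h1 (Metric.closedBall_mem_nhds _ hr)
  obtain ⟨c, hc, hcs⟩ := (mem_nhdsGE_iff_exists_Icc_subset).1
    (hwc.and (Icc_mem_nhdsGE (show σ < σ + ε by linarith)))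
  have hc' : σ < c := hc
  have hcε : c ≤ σ + ε := (hcs (right_mem_Icc.2 hc'.le)).2.2
  have hcS : c ∈ S := by
    refine ⟨⟨by linarith, by linarith⟩, fun t => if t ≤ σ then u t else w t, by simp [hσ0, hu0], ?_⟩
    intro t ht
    set h : ℝ → X := fun t => if t ≤ σ then u t else w t with hh
    have e1 : ∀ s ∈ Icc 0 σ, h s = u s := fun s hs => by simp [hh, hs.2]
    have e2 : ∀ s ∈ Icc σ c, h s = w s := fun s hs => by
      rcases hs.1.eq_or_lt with rfl | h'
      · simp [hh, hw0, hy]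
      · simp [hh, h'.not_ge]
    have hd1 : HasDerivWithinAt h (F t (h t)) (Icc 0 σ) t := by
      by_cases hm : t ∈ Icc 0 σ
      · rw [e1 t hm]
        exact (hu t hm).2.congr e1 (e1 t hm)
      · exact HasFDerivWithinAt.of_notMem_closure (by rwa [isClosed_Icc.closure_eq])
    have hd2 : HasDerivWithinAt h (F t (h t)) (Icc σ c) t := by
      by_cases hm : t ∈ Icc σ c
      · rw [e2 t hm]
        exact ((hw t ⟨hm.1, hm.2.trans hcε⟩).mono (Icc_subset_Icc_right hcε)).congr e2 (e2 t hm)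
      · exact HasFDerivWithinAt.of_notMem_closure (by rwa [isClosed_Icc.closure_eq])
    refine ⟨?_, ?_⟩
    · rcases le_total t σ with h' | h'
      · rw [e1 t ⟨ht.1, h'⟩]; exact (hu t ⟨ht.1, h'⟩).1
      · rw [e2 t ⟨h', ht.2⟩]; exact hball (hcs ⟨h', ht.2⟩).1
    · rw [← Icc_union_Icc_eq_Icc hσ0 hc'.le]
      exact hd1.union hd2
  exact absurd (le_csSup hbdd hcS) (not_le.2 hc')

end abstractODE

open scoped ZeroAtInfty

section C01sec

variable {F : Type*} [NormedAddCommGroup F] [NormedSpace ℝ F]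

theorem yk_c0_apply_le {G : Type*} [NormedAddCommGroup G] (f : C₀(E3, G)) (x : E3) : ‖f x‖ ≤ ‖f‖ :=
  f.toBCF.norm_coe_le_norm x

theorem yk_c0_norm_le {G : Type*} [NormedAddCommGroup G] (f : C₀(E3, G)) {c : ℝ} (hc : 0 ≤ c)
    (h : ∀ x, ‖f x‖ ≤ c) : ‖f‖ ≤ c :=
  (f.toBCF.norm_le hc).2 h

/-- Ambient space. -/
def YP (F : Type*) [NormedAddCommGroup F] [NormedSpace ℝ F] : Type _ :=
  C₀(E3, F) × C₀(E3, E3 →L[ℝ] F)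

instance : NormedAddCommGroup (YP F) :=
  inferInstanceAs (NormedAddCommGroup (C₀(E3, F) × C₀(E3, E3 →L[ℝ] F)))
instance : NormedSpace ℝ (YP F) :=
  inferInstanceAs (NormedSpace ℝ (C₀(E3, F) × C₀(E3, E3 →L[ℝ] F)))
instance [CompleteSpace F] : CompleteSpace (YP F) :=
  inferInstanceAs (CompleteSpace (C₀(E3, F) × C₀(E3, E3 →L[ℝ] F)))

/-- The space of `C¹` functions vanishing at infinity with their derivative. -/
def YCs (F : Type*) [NormedAddCommGroup F] [NormedSpace ℝ F] :
    Submodule ℝ (YP F) where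
  carrier := {p | ∀ x, HasFDerivAt p.1 (p.2 x) x}
  add_mem' := fun hp hq x => (hp x).add (hq x)
  zero_mem' := fun x => hasFDerivAt_const (0:F) x
  smul_mem' := fun c _ hp x => (hp x).const_smul c

theorem YCs_isClosed (F : Type*) [NormedAddCommGroup F] [NormedSpace ℝ F] :
    IsClosed (YCs F : Set (YP F)) := by
  apply isClosed_of_closure_subset
  intro q hq
  obtain ⟨p, hp, hpq⟩ := mem_closure_iff_seq_limit.1 hq
  intro x
  have h1 := (ZeroAtInftyContinuousMap.tendsto_iff_tendstoUniformly).1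
    (((continuous_fst : Continuous fun p : C₀(E3, F) × C₀(E3, E3 →L[ℝ] F) => p.1).tendsto q).comp hpq)
  have h2 := (ZeroAtInftyContinuousMap.tendsto_iff_tendstoUniformly).1
    (((continuous_snd : Continuous fun p : C₀(E3, F) × C₀(E3, E3 →L[ℝ] F) => p.2).tendsto q).comp hpq)
  exact hasFDerivAt_of_tendstoUniformly h2 (fun n y => hp n y) (fun y => h1.tendsto_at y) x

/-- The space `YCs` as a type. -/
def YC (F : Type*) [NormedAddCommGroup F] [NormedSpace ℝ F] : Type _ := ↥(YCs F)

instance : NormedAddCommGroup (YC F) := inferInstanceAs (NormedAddCommGroup ↥(YCs F))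
instance : NormedSpace ℝ (YC F) := inferInstanceAs (NormedSpace ℝ ↥(YCs F))
instance [CompleteSpace F] : CompleteSpace (YC F) := (YCs_isClosed F).completeSpace_coe

namespace YC

/-- The function. -/
def f (u : YC F) : C₀(E3, F) := (show ↥(YCs F) from u).1.1

/-- The derivative. -/
def D (u : YC F) : C₀(E3, E3 →L[ℝ] F) := (show ↥(YCs F) from u).1.2

theorem hasFDerivAt (u : YC F) (x : E3) : HasFDerivAt u.f (u.D x) x :=
  (show ↥(YCs F) from u).2 x

theorem norm_f (u : YC F) (x : E3) : ‖u.f x‖ ≤ ‖u‖ :=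
  (yk_c0_apply_le _ x).trans (le_max_left _ _)

theorem norm_D (u : YC F) (x : E3) : ‖u.D x‖ ≤ ‖u‖ :=
  (yk_c0_apply_le _ x).trans (le_max_right _ _)

theorem norm_le (u : YC F) {c : ℝ} (hc : 0 ≤ c) (h1 : ∀ x, ‖u.f x‖ ≤ c) (h2 : ∀ x, ‖u.D x‖ ≤ c) :
    ‖u‖ ≤ c :=
  max_le (yk_c0_norm_le _ hc h1) (yk_c0_norm_le _ hc h2)

theorem ext' {u w : YC F} (h : ∀ x, u.f x = w.f x) : u = w := by
  have h1 : u.f = w.f := ZeroAtInftyContinuousMap.ext h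
  have h2 : u.D = w.D := by
    ext1 x
    have a := u.hasFDerivAt x
    rw [h1] at a
    exact a.unique (w.hasFDerivAt x)
  exact Subtype.ext (Prod.ext h1 h2 : (show ↥(YCs F) from u).1 = (show ↥(YCs F) from w).1)

theorem lip (u : YC F) (x y : E3) : ‖u.f x - u.f y‖ ≤ ‖u‖ * ‖x - y‖ :=
  convex_univ.norm_image_sub_le_of_norm_hasFDerivWithin_le
    (fun z _ => (u.hasFDerivAt z).hasFDerivWithinAt) (fun z _ => u.norm_D z) (mem_univ y) (mem_univ x)

/-- Constructor. -/
def mk' (f : E3 → F) (f' : E3 → E3 →L[ℝ] F) (hd : ∀ x, HasFDerivAt f (f' x) x) (hc : Continuous f')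
    (h0 : Tendsto f (cocompact E3) (𝓝 0)) (h1 : Tendsto f' (cocompact E3) (𝓝 0)) : YC F :=
  ⟨(⟨⟨f, continuous_iff_continuousAt.2 fun x => (hd x).continuousAt⟩, h0⟩, ⟨⟨f', hc⟩, h1⟩), hd⟩

/-- Evaluation of the function. -/
def ev (x : E3) : YC F →L[ℝ] F :=
  LinearMap.mkContinuous ⟨⟨fun u => u.f x, fun _ _ => rfl⟩, fun _ _ => rfl⟩ 1
    (fun u => by rw [one_mul]; exact u.norm_f x)

/-- Evaluation of the derivative. -/
def evD (x : E3) : YC F →L[ℝ] (E3 →L[ℝ] F) :=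
  LinearMap.mkContinuous ⟨⟨fun u => u.D x, fun _ _ => rfl⟩, fun _ _ => rfl⟩ 1
    (fun u => by rw [one_mul]; exact u.norm_D x)

theorem ev_apply (x : E3) (u : YC F) : ev x u = u.f x := rfl
theorem evD_apply (x : E3) (u : YC F) : evD x u = u.D x := rfl

theorem tendsto_add (u : C₀(E3, E3)) : Tendsto (fun x => x + u x) (cocompact E3) (cocompact E3) := by
  rw [← Metric.cobounded_eq_cocompact, ← tendsto_norm_atTop_iff_cobounded]
  have h1 : Tendsto (fun x : E3 => ‖x‖ + -‖u‖) (Bornology.cobounded E3) atTop :=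
    tendsto_atTop_add_const_right _ _ tendsto_norm_cobounded_atTop
  refine tendsto_atTop_mono (fun x => ?_) h1
  have h2 := yk_c0_apply_le u x
  have h3 : ‖x‖ ≤ ‖x + u x‖ + ‖u x‖ := by
    calc ‖x‖ = ‖(x + u x) - u x‖ := by simp
      _ ≤ _ := norm_sub_le _ _
  linarith

theorem hasFDerivAt_id_add (u : YC E3) (x : E3) :
    HasFDerivAt (fun x => x + u.f x) (ContinuousLinearMap.id ℝ E3 + u.D x) x :=
  (hasFDerivAt_id x).add (u.hasFDerivAt x)

theorem norm_id_add (u : YC E3) (x : E3) : ‖ContinuousLinearMap.id ℝ E3 + u.D x‖ ≤ 1 + ‖u‖ :=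
  (norm_add_le _ _).trans (add_le_add ContinuousLinearMap.norm_id_le (u.norm_D x))

/-- Composition `w ∘ (id + u)`. -/
def comp (w : YC F) (u : YC E3) : YC F :=
  mk' (fun x => w.f (x + u.f x))
    (fun x => (w.D (x + u.f x)).comp (ContinuousLinearMap.id ℝ E3 + u.D x))
    (fun x => (w.hasFDerivAt _).comp x (u.hasFDerivAt_id_add x))
    (by
      have h1 : Continuous fun x => u.f x := map_continuous u.f
      have h2 : Continuous fun x => u.D x := map_continuous u.D
      have h3 : Continuous fun x => w.D x := map_continuous w.D
      exact (h3.comp (continuous_id.add h1)).clm_comp (continuous_const.add h2))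
    ((zero_at_infty w.f).comp (tendsto_add u.f))
    (by
      have h := ((zero_at_infty w.D).comp (tendsto_add u.f)).norm.mul_const (1 + ‖u‖)
      rw [norm_zero, zero_mul] at h
      refine squeeze_zero_norm (fun x => ?_) h
      refine (ContinuousLinearMap.opNorm_comp_le _ _).trans ?_
      gcongr
      · exact le_rfl
      · exact u.norm_id_add x)

theorem comp_f (w : YC F) (u : YC E3) (x : E3) : (comp w u).f x = w.f (x + u.f x) := rfl
theorem comp_D (w : YC F) (u : YC E3) (x : E3) : (comp w u).D x =
  (w.D (x + u.f x)).comp (ContinuousLinearMap.id ℝ E3 + u.D x) := rfl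

theorem norm_comp_le (w : YC F) (u : YC E3) : ‖comp w u‖ ≤ ‖w‖ * (1 + ‖u‖) := by
  apply norm_le _ (by positivity)
  · intro x
    rw [comp_f]
    refine (w.norm_f _).trans (le_mul_of_one_le_right (norm_nonneg _) (by linarith [norm_nonneg u]))
  · intro x
    rw [comp_D]
    refine (ContinuousLinearMap.opNorm_comp_le _ _).trans ?_
    gcongr
    · exact w.norm_D _
    · exact u.norm_id_add x

theorem comp_sub_left (w w' : YC F) (u : YC E3) : comp w u - comp w' u = comp (w - w') u :=
  ext' fun _ => rfl

theorem norm_comp_sub_le (w : YC F) (u u' : YC E3) {δ : ℝ} (hδ : 0 ≤ δ)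
    (h : ∀ x, ‖w.D (x + u.f x) - w.D (x + u'.f x)‖ ≤ δ) :
    ‖comp w u - comp w u'‖ ≤ δ * (1 + ‖u‖) + ‖w‖ * ‖u - u'‖ := by
  apply norm_le _ (by positivity)
  · intro x
    change ‖w.f (x + u.f x) - w.f (x + u'.f x)‖ ≤ _
    have h1 := w.lip (x + u.f x) (x + u'.f x)
    have h2 : ‖(x + u.f x) - (x + u'.f x)‖ ≤ ‖u - u'‖ := by
      rw [add_sub_add_left_eq_sub]
      exact (u - u').norm_f x
    have h3 : 0 ≤ δ * (1 + ‖u‖) := by positivity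
    calc _ ≤ _ := h1
      _ ≤ ‖w‖ * ‖u - u'‖ := by gcongr
      _ ≤ _ := by linarith
  · intro x
    change ‖(w.D (x + u.f x)).comp (ContinuousLinearMap.id ℝ E3 + u.D x) -
      (w.D (x + u'.f x)).comp (ContinuousLinearMap.id ℝ E3 + u'.D x)‖ ≤ _
    have e : (w.D (x + u.f x)).comp (ContinuousLinearMap.id ℝ E3 + u.D x) -
      (w.D (x + u'.f x)).comp (ContinuousLinearMap.id ℝ E3 + u'.D x) =
      (w.D (x + u.f x) - w.D (x + u'.f x)).comp (ContinuousLinearMap.id ℝ E3 + u.D x) +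
      (w.D (x + u'.f x)).comp ((u - u').D x) := by
      have : (u - u').D x = u.D x - u'.D x := rfl
      rw [this]
      rw [ContinuousLinearMap.sub_comp, ContinuousLinearMap.comp_sub, ContinuousLinearMap.comp_add,
        ContinuousLinearMap.comp_add, ContinuousLinearMap.comp_add]
      abel
    rw [e]
    refine (norm_add_le _ _).trans (add_le_add ?_ ?_)
    · refine (ContinuousLinearMap.opNorm_comp_le _ _).trans ?_
      gcongr
      · exact h x
      · exact u.norm_id_add x
    · refine (ContinuousLinearMap.opNorm_comp_le _ _).trans ?_
      gcongr
      · exact w.norm_D _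
      · exact (u - u').norm_D x

theorem tendsto_comp {ι : Type*} {l : Filter ι} {w : ι → YC F} {u : ι → YC E3} {w₀ : YC F} {u₀ : YC E3}
    (hw : Tendsto w l (𝓝 w₀)) (hu : Tendsto u l (𝓝 u₀)) :
    Tendsto (fun i => comp (w i) (u i)) l (𝓝 (comp w₀ u₀)) := by
  have hwn := tendsto_iff_norm_sub_tendsto_zero.1 hw
  have hun := tendsto_iff_norm_sub_tendsto_zero.1 hu
  have h1 : Tendsto (fun i => comp (w i) (u i) - comp w₀ (u i)) l (𝓝 0) := by
    have h : Tendsto (fun i => ‖w i - w₀‖ * (1 + ‖u i‖)) l (𝓝 0) := by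
      have := hwn.mul (hu.norm.const_add 1)
      simpa using this
    refine squeeze_zero_norm (fun i => ?_) h
    rw [comp_sub_left]
    exact norm_comp_le _ _
  have h2 : Tendsto (fun i => comp w₀ (u i) - comp w₀ u₀) l (𝓝 0) := by
    have hg : Tendsto (fun i => ‖w₀‖ * ‖u i - u₀‖) l (𝓝 0) := by simpa using hun.const_mul ‖w₀‖
    have huc : UniformContinuous w₀.D := ZeroAtInftyContinuousMap.uniformContinuous _
    rw [Metric.uniformContinuous_iff] at huc
    rw [tendsto_zero_iff_norm_tendsto_zero, Metric.tendsto_nhds]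
    intro ε hε
    have hM : 0 < ‖u₀‖ + 2 := by positivity
    obtain ⟨δ, hδ, hδ'⟩ := huc (ε / (2 * (‖u₀‖ + 2))) (by positivity)
    have e1 : ∀ᶠ i in l, ‖u i‖ < ‖u₀‖ + 1 := hu.norm.eventually_lt_const (by linarith)
    have e2 : ∀ᶠ i in l, ‖u i - u₀‖ < δ := hun.eventually_lt_const hδ
    have e3 : ∀ᶠ i in l, ‖w₀‖ * ‖u i - u₀‖ < ε / 2 := hg.eventually_lt_const (by positivity)
    filter_upwards [e1, e2, e3] with i h1 h2 h3
    rw [Real.dist_eq, sub_zero, abs_norm]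
    have := norm_comp_sub_le w₀ (u i) u₀ (δ := ε / (2 * (‖u₀‖ + 2))) (by positivity) (by
      intro x
      rw [← dist_eq_norm]
      apply (hδ' _).le
      rw [dist_eq_norm, add_sub_add_left_eq_sub]
      exact ((u i - u₀).norm_f x).trans_lt h2)
    have h5 : ε / (2 * (‖u₀‖ + 2)) * (1 + ‖u i‖) ≤ ε / 2 := by
      calc _ ≤ ε / (2 * (‖u₀‖ + 2)) * (‖u₀‖ + 2) :=
            mul_le_mul_of_nonneg_left (by linarith) (by positivity)
        _ = ε / 2 := by field_simp
    linarith
  rw [tendsto_iff_norm_sub_tendsto_zero, ← tendsto_zero_iff_norm_tendsto_zero]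
  simpa using h1.add h2

theorem yk_mul_bound (b N : E3 →L[ℝ] E3) (b' N' : E3 →L[ℝ] E3 →L[ℝ] E3) :
    ‖(ContinuousLinearMap.compL ℝ E3 E3 E3 b).comp N' +
      ((ContinuousLinearMap.compL ℝ E3 E3 E3).flip N).comp b'‖ ≤ ‖b‖ * ‖N'‖ + ‖N‖ * ‖b'‖ := by
  have h0 : 0 ≤ ‖b‖ * ‖N'‖ + ‖N‖ * ‖b'‖ :=
    add_nonneg (mul_nonneg (norm_nonneg b) (norm_nonneg N'))
      (mul_nonneg (norm_nonneg N) (norm_nonneg b'))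
  refine ContinuousLinearMap.opNorm_le_bound _ h0 fun y => ?_
  have h1 : ‖b.comp (N' y)‖ ≤ ‖b‖ * (‖N'‖ * ‖y‖) :=
    (ContinuousLinearMap.opNorm_comp_le _ _).trans
      (mul_le_mul_of_nonneg_left (ContinuousLinearMap.le_opNorm _ _) (norm_nonneg _))
  have h2 : ‖(b' y).comp N‖ ≤ (‖b'‖ * ‖y‖) * ‖N‖ :=
    (ContinuousLinearMap.opNorm_comp_le _ _).trans
      (mul_le_mul_of_nonneg_right (ContinuousLinearMap.le_opNorm _ _) (norm_nonneg _))
  have h3 : ‖b.comp (N' y) + (b' y).comp N‖ ≤ _ := norm_add_le _ _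
  calc _ ≤ _ := h3
    _ ≤ _ := add_le_add h1 h2
    _ = _ := by ring

/-- Pointwise product of operator-valued functions. -/
def mul (b N : YC (E3 →L[ℝ] E3)) : YC (E3 →L[ℝ] E3) :=
  mk' (fun x => (b.f x).comp (N.f x))
    (fun x => (ContinuousLinearMap.compL ℝ E3 E3 E3 (b.f x)).comp (N.D x) +
      ((ContinuousLinearMap.compL ℝ E3 E3 E3).flip (N.f x)).comp (b.D x))
    (fun x => (b.hasFDerivAt x).clm_comp (N.hasFDerivAt x))
    (by
      have h1 : Continuous fun x => b.f x := map_continuous b.f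
      have h2 : Continuous fun x => b.D x := map_continuous b.D
      have h3 : Continuous fun x => N.f x := map_continuous N.f
      have h4 : Continuous fun x => N.D x := map_continuous N.D
      fun_prop)
    (by
      have h := (zero_at_infty b.f).norm.mul (zero_at_infty N.f).norm
      rw [norm_zero, mul_zero] at h
      exact squeeze_zero_norm (fun x => ContinuousLinearMap.opNorm_comp_le _ _) h)
    (by
      have h1 := (zero_at_infty b.f).norm.mul (zero_at_infty N.D).norm
      have h2 := (zero_at_infty N.f).norm.mul (zero_at_infty b.D).norm
      have h := h1.add h2
      rw [norm_zero, norm_zero, mul_zero, add_zero] at h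
      exact squeeze_zero_norm (fun x => yk_mul_bound _ _ _ _) h)

theorem mul_f (b N : YC (E3 →L[ℝ] E3)) (x : E3) : (mul b N).f x = (b.f x).comp (N.f x) := rfl

theorem norm_mul_le' (b N : YC (E3 →L[ℝ] E3)) : ‖mul b N‖ ≤ 2 * ‖b‖ * ‖N‖ := by
  have h0 : 0 ≤ ‖b‖ * ‖N‖ := mul_nonneg (norm_nonneg _) (norm_nonneg _)
  apply norm_le _ (by linarith)
  · intro x
    rw [mul_f]
    have h1 : ‖b.f x‖ * ‖N.f x‖ ≤ ‖b‖ * ‖N‖ :=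
      mul_le_mul (b.norm_f x) (N.norm_f x) (norm_nonneg _) (norm_nonneg _)
    have h2 := ContinuousLinearMap.opNorm_comp_le (b.f x) (N.f x)
    linarith
  · intro x
    have h := yk_mul_bound (b.f x) (N.f x) (b.D x) (N.D x)
    have h1 : ‖b.f x‖ * ‖N.D x‖ ≤ ‖b‖ * ‖N‖ :=
      mul_le_mul (b.norm_f x) (N.norm_D x) (norm_nonneg _) (norm_nonneg _)
    have h2 : ‖N.f x‖ * ‖b.D x‖ ≤ ‖N‖ * ‖b‖ :=
      mul_le_mul (N.norm_f x) (b.norm_D x) (norm_nonneg _) (norm_nonneg _)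
    refine h.trans ?_
    linarith

/-- The product as a bilinear map. -/
def mulL : YC (E3 →L[ℝ] E3) →L[ℝ] YC (E3 →L[ℝ] E3) →L[ℝ] YC (E3 →L[ℝ] E3) :=
  LinearMap.mkContinuous₂ (LinearMap.mk₂ ℝ mul
    (fun b b' N => ext' fun x => by
      change (b.f x + b'.f x).comp (N.f x) = (b.f x).comp (N.f x) + (b'.f x).comp (N.f x)
      exact ContinuousLinearMap.add_comp _ _ _)
    (fun c b N => ext' fun x => by
      change (c • b.f x).comp (N.f x) = c • (b.f x).comp (N.f x)
      exact ContinuousLinearMap.smul_comp _ _ _)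
    (fun b N N' => ext' fun x => by
      change (b.f x).comp (N.f x + N'.f x) = (b.f x).comp (N.f x) + (b.f x).comp (N'.f x)
      exact ContinuousLinearMap.comp_add _ _ _)
    (fun c b N => ext' fun x => by
      change (b.f x).comp (c • N.f x) = c • (b.f x).comp (N.f x)
      exact ContinuousLinearMap.comp_smul _ _ _)) 2 norm_mul_le'

theorem mulL_apply (b N : YC (E3 →L[ℝ] E3)) : mulL b N = mul b N := rfl

end YC

end C01sec


section P3sec

theorem yk_norm_it2 (v : E3 → E3) (x : E3) :
    ‖iteratedFDeriv ℝ 2 v x‖ = ‖fderiv ℝ (fderiv ℝ v) x‖ := by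
  rw [← norm_iteratedFDeriv_one (f := fderiv ℝ v), norm_iteratedFDeriv_fderiv]

/-- Element of `YC` from a `C₀¹` field. -/
def YC.ofMem (v : E3 → E3) (h : MemC0 1 v) : YC E3 :=
  YC.mk' v (fderiv ℝ v)
    (fun x => (h.1.differentiable (by norm_num) x).hasFDerivAt)
    (h.1.continuous_fderiv (by norm_num))
    (by
      rw [tendsto_zero_iff_norm_tendsto_zero]
      simpa only [norm_iteratedFDeriv_zero] using h.2 0 (by norm_num))
    (by
      rw [tendsto_zero_iff_norm_tendsto_zero]
      simpa only [norm_iteratedFDeriv_one] using h.2 1 le_rfl)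

theorem YC.ofMem_f (v : E3 → E3) (h : MemC0 1 v) (x : E3) : (YC.ofMem v h).f x = v x := rfl
theorem YC.ofMem_D (v : E3 → E3) (h : MemC0 1 v) (x : E3) : (YC.ofMem v h).D x = fderiv ℝ v x := rfl

theorem MemC0.one {v : E3 → E3} (h : MemC0 2 v) : MemC0 1 v :=
  ⟨h.1.of_le (by norm_num), fun k hk => h.2 k (by omega)⟩

/-- Derivative of a `C₀²` field. -/
def YC.ofMem2 (v : E3 → E3) (h : MemC0 2 v) : YC (E3 →L[ℝ] E3) :=
  have h1 : ContDiff ℝ 1 (fderiv ℝ v) := h.1.fderiv_right (by norm_num)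
  YC.mk' (fderiv ℝ v) (fderiv ℝ (fderiv ℝ v))
    (fun x => (h1.differentiable (by norm_num) x).hasFDerivAt)
    (h1.continuous_fderiv (by norm_num))
    (by
      rw [tendsto_zero_iff_norm_tendsto_zero]
      simpa only [norm_iteratedFDeriv_one] using h.2 1 (by norm_num))
    (by
      rw [tendsto_zero_iff_norm_tendsto_zero]
      simpa only [yk_norm_it2] using h.2 2 le_rfl)

theorem YC.ofMem2_f (v : E3 → E3) (h : MemC0 2 v) (x : E3) :
    (YC.ofMem2 v h).f x = (YC.ofMem v h.one).D x := rfl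

theorem yk_supDeriv_nonneg (k : ℕ) (v : E3 → E3) : 0 ≤ supDeriv k v :=
  Real.iSup_nonneg fun _ => norm_nonneg _

theorem yk_normS_one (v : E3 → E3) : normS 1 v = supDeriv 0 v + supDeriv 1 v := by
  simp [normS, Finset.sum_range_succ]

theorem yk_normS_two (v : E3 → E3) : normS 2 v = supDeriv 0 v + supDeriv 1 v + supDeriv 2 v := by
  simp [normS, Finset.sum_range_succ]

theorem YC.fderiv_f (u : YC E3) : fderiv ℝ u.f = u.D := by
  ext1 x
  exact (u.hasFDerivAt x).fderiv

theorem YC.sup0_le (u : YC E3) : supDeriv 0 u.f ≤ ‖u‖ :=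
  ciSup_le fun x => by rw [norm_iteratedFDeriv_zero]; exact u.norm_f x

theorem YC.sup1_le (u : YC E3) : supDeriv 1 u.f ≤ ‖u‖ :=
  ciSup_le fun x => by rw [norm_iteratedFDeriv_one, u.fderiv_f]; exact u.norm_D x

theorem YC.le_sup0 (u : YC E3) (x : E3) : ‖u.f x‖ ≤ supDeriv 0 u.f := by
  have : BddAbove (range fun x => ‖iteratedFDeriv ℝ 0 u.f x‖) := by
    refine ⟨‖u‖, ?_⟩
    rintro _ ⟨y, rfl⟩
    simp only [norm_iteratedFDeriv_zero]
    exact u.norm_f y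
  have h := le_ciSup this x
  rw [norm_iteratedFDeriv_zero] at h
  exact h

theorem YC.le_sup1 (u : YC E3) (x : E3) : ‖u.D x‖ ≤ supDeriv 1 u.f := by
  have : BddAbove (range fun x => ‖iteratedFDeriv ℝ 1 u.f x‖) := by
    refine ⟨‖u‖, ?_⟩
    rintro _ ⟨y, rfl⟩
    simp only [norm_iteratedFDeriv_one, u.fderiv_f]
    exact u.norm_D y
  have h := le_ciSup this x
  rw [norm_iteratedFDeriv_one, u.fderiv_f] at h
  exact h

theorem YC.normS_le (u : YC E3) : normS 1 u.f ≤ 2 * ‖u‖ := by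
  rw [yk_normS_one]
  linarith [u.sup0_le, u.sup1_le]

theorem YC.le_normS (u : YC E3) : ‖u‖ ≤ normS 1 u.f := by
  rw [yk_normS_one]
  have h0 := yk_supDeriv_nonneg 0 u.f
  have h1 := yk_supDeriv_nonneg 1 u.f
  refine u.norm_le (by linarith) (fun x => ?_) fun x => ?_
  · linarith [u.le_sup0 x]
  · linarith [u.le_sup1 x]

theorem YC.normS2_le (u : YC E3) (N : YC (E3 →L[ℝ] E3)) (h : ∀ x, N.f x = u.D x) :
    normS 2 u.f ≤ 2 * ‖u‖ + ‖N‖ := by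
  rw [yk_normS_two]
  have h2 : supDeriv 2 u.f ≤ ‖N‖ := ciSup_le fun x => by
    rw [yk_norm_it2, u.fderiv_f, ← show (N.f : E3 → E3 →L[ℝ] E3) = u.D from funext h,
      (N.hasFDerivAt x).fderiv]
    exact N.norm_D x
  linarith [u.sup0_le, u.sup1_le]

theorem YC.ofMem_norm_le {v : E3 → E3} (h : MemC0 2 v) : ‖YC.ofMem v h.one‖ ≤ normS 2 v := by
  refine (YC.le_normS _).trans ?_
  change normS 1 v ≤ _
  rw [yk_normS_one, yk_normS_two]
  linarith [yk_supDeriv_nonneg 2 v]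

theorem YC.ofMem2_norm_le {v : E3 → E3} (h : MemC0 2 v) : ‖YC.ofMem2 v h‖ ≤ normS 2 v := by
  have h0 := yk_supDeriv_nonneg 0 v
  have h1 := yk_supDeriv_nonneg 1 v
  have h2 := yk_supDeriv_nonneg 2 v
  rw [yk_normS_two]
  have hb : BddAbove (range fun x => ‖iteratedFDeriv ℝ 2 v x‖) := by
    refine ⟨‖YC.ofMem2 v h‖, ?_⟩
    rintro _ ⟨y, rfl⟩
    simp only [yk_norm_it2]
    exact (YC.ofMem2 v h).norm_D y
  refine YC.norm_le _ (by linarith) (fun x => ?_) fun x => ?_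
  · have := (YC.ofMem v h.one).le_sup1 x
    change ‖fderiv ℝ v x‖ ≤ supDeriv 1 v at this
    change ‖fderiv ℝ v x‖ ≤ _
    linarith
  · have := le_ciSup hb x
    rw [yk_norm_it2] at this
    change ‖fderiv ℝ (fderiv ℝ v) x‖ ≤ supDeriv 2 v at this
    change ‖fderiv ℝ (fderiv ℝ v) x‖ ≤ _
    linarith

theorem YC.contDiff (u : YC E3) : ContDiff ℝ 1 u.f := by
  rw [contDiff_one_iff_fderiv]
  refine ⟨fun x => (u.hasFDerivAt x).differentiableAt, ?_⟩
  rw [u.fderiv_f]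
  exact map_continuous u.D

theorem YC.memC0 (u : YC E3) : MemC0 1 u.f := by
  refine ⟨u.contDiff, fun k hk => ?_⟩
  interval_cases k
  · simp only [norm_iteratedFDeriv_zero]
    exact tendsto_zero_iff_norm_tendsto_zero.1 (zero_at_infty u.f)
  · simp only [norm_iteratedFDeriv_one, u.fderiv_f]
    exact tendsto_zero_iff_norm_tendsto_zero.1 (zero_at_infty u.D)

theorem YC.memC02 (u : YC E3) (N : YC (E3 →L[ℝ] E3)) (h : ∀ x, N.f x = u.D x) : MemC0 2 u.f := by
  have hN : (N.f : E3 → E3 →L[ℝ] E3) = u.D := funext h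
  have hD : fderiv ℝ N.f = N.D := funext fun x => (N.hasFDerivAt x).fderiv
  have hc : ContDiff ℝ 1 N.f := by
    rw [contDiff_one_iff_fderiv]
    refine ⟨fun x => (N.hasFDerivAt x).differentiableAt, ?_⟩
    rw [hD]
    exact map_continuous N.D
  refine ⟨?_, fun k hk => ?_⟩
  · have : ((2 : ℕ) : WithTop ℕ∞) = 1 + 1 := by norm_num
    rw [this, contDiff_succ_iff_fderiv]
    refine ⟨fun x => (u.hasFDerivAt x).differentiableAt, by simp, ?_⟩
    rw [u.fderiv_f, ← hN]
    exact hc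
  · rcases Nat.lt_or_ge k 2 with h2 | h2
    · exact u.memC0.2 k (by omega)
    · obtain rfl : k = 2 := by omega
      simp only [yk_norm_it2, u.fderiv_f, ← hN, hD]
      exact tendsto_zero_iff_norm_tendsto_zero.1 (zero_at_infty N.D)

/-- Displacement of a diffeomorphism. -/
def DiffId.disp (φ : DiffId 1) : YC E3 := YC.ofMem _ φ.memC0

theorem DiffId.disp_f (φ : DiffId 1) (x : E3) : φ.disp.f x = φ x - x := rfl

theorem DiffId.ext_fun {φ ψ : DiffId 1} (h : ∀ x, φ x = ψ x) : φ = ψ := by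
  have h1 : φ.toFun = ψ.toFun := funext h
  have h2 : φ.invFun = ψ.invFun := by
    funext y
    have : y = ψ.toFun (ψ.invFun y) := (ψ.right_inv y).symm
    conv_lhs => rw [this, ← h1]
    exact φ.left_inv _
  cases φ
  cases ψ
  simp only at h1 h2
  subst h1
  subst h2
  rfl

theorem DiffId.ext_disp {φ ψ : DiffId 1} (h : φ.disp = ψ.disp) : φ = ψ := by
  apply DiffId.ext_fun
  intro x
  have : φ.disp.f x = ψ.disp.f x := by rw [h]
  rw [φ.disp_f, ψ.disp_f] at this
  exact sub_left_injective this

theorem yk_distS_eq (φ ψ : DiffId 1) : distS 1 φ ψ = normS 1 (φ.disp - ψ.disp).f := by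
  unfold distS
  congr 1
  ext1 x
  change φ x - ψ x = (φ x - x) - (ψ x - x)
  abel

theorem yk_distS_le (φ ψ : DiffId 1) : distS 1 φ ψ ≤ 2 * ‖φ.disp - ψ.disp‖ := by
  rw [yk_distS_eq]
  exact YC.normS_le _

theorem yk_le_distS (φ ψ : DiffId 1) : ‖φ.disp - ψ.disp‖ ≤ distS 1 φ ψ := by
  rw [yk_distS_eq]
  exact YC.le_normS _

/-- Displacements `u` such that `id + u` is expanding by some factor. -/
def YU : Set (YC E3) := {u | ∃ M : ℝ, 0 ≤ M ∧ ∀ x y, ‖x - y‖ ≤ M * ‖(x + u.f x) - (y + u.f y)‖}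

theorem DiffId.disp_mem (φ : DiffId 1) : φ.disp ∈ YU := by
  refine ⟨1 + ‖YC.ofMem _ φ.memC0_inv‖, by positivity, fun x y => ?_⟩
  have hx : ∀ x, x + φ.disp.f x = φ x := fun x => by rw [φ.disp_f]; abel
  rw [hx, hx]
  have h := (YC.ofMem _ φ.memC0_inv).lip (φ x) (φ y)
  rw [YC.ofMem_f, YC.ofMem_f, φ.left_inv x, φ.left_inv y] at h
  have h2 : x - y = (φ x - φ y) + ((x - φ x) - (y - φ y)) := by abel
  calc ‖x - y‖ = ‖(φ x - φ y) + ((x - φ x) - (y - φ y))‖ := by rw [← h2]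
    _ ≤ _ := norm_add_le _ _
    _ ≤ _ := by linarith

theorem yk_YU_ball {u : YC E3} (hu : u ∈ YU) : ∃ r > 0, ∀ w : YC E3, ‖w - u‖ ≤ r → w ∈ YU := by
  obtain ⟨M, hM, h⟩ := hu
  refine ⟨1 / (2 * (M + 1)), by positivity, fun w hw => ⟨2 * M, by positivity, fun x y => ?_⟩⟩
  have h1 := (w - u).lip x y
  have e : (w - u).f x - (w - u).f y = (w.f x - u.f x) - (w.f y - u.f y) := rfl
  rw [e] at h1
  have h2 : (x + u.f x) - (y + u.f y) =
      ((x + w.f x) - (y + w.f y)) - ((w.f x - u.f x) - (w.f y - u.f y)) := by abel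
  have h3 := h x y
  rw [h2] at h3
  have h4 := norm_sub_le ((x + w.f x) - (y + w.f y)) ((w.f x - u.f x) - (w.f y - u.f y))
  have h5 : ‖w - u‖ * ‖x - y‖ ≤ 1 / (2 * (M + 1)) * ‖x - y‖ :=
    mul_le_mul_of_nonneg_right hw (norm_nonneg _)
  have h6 : M * (1 / (2 * (M + 1)) * ‖x - y‖) ≤ 1 / 2 * ‖x - y‖ := by
    rw [← mul_assoc]
    apply mul_le_mul_of_nonneg_right _ (norm_nonneg _)
    rw [mul_one_div, div_le_div_iff₀ (by positivity) (by positivity)]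
    linarith
  have h7 := mul_le_mul_of_nonneg_left (h4.trans (add_le_add_right (h1.trans h5) _)) hM
  rw [mul_add] at h7
  linarith

theorem yk_YU_inv {u : YC E3} {M : ℝ} (hM : 0 ≤ M)
    (h : ∀ x y, ‖x - y‖ ≤ M * ‖(x + u.f x) - (y + u.f y)‖) :
    ∃ ψ : E3 → E3, Function.LeftInverse ψ (fun x => x + u.f x) ∧
      Function.RightInverse ψ (fun x => x + u.f x) ∧ MemC0 1 fun x => ψ x - x := by
  set g : E3 → E3 := fun x => x + u.f x with hg
  have hcg : ContDiff ℝ 1 g := contDiff_id.add u.contDiff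
  have hanti : AntilipschitzWith ⟨M, hM⟩ g := by
    apply AntilipschitzWith.of_le_mul_dist
    intro x y
    rw [dist_eq_norm, dist_eq_norm]
    exact h x y
  -- derivative is bounded below
  have hder : ∀ x y : E3, ‖y‖ ≤ M * ‖(ContinuousLinearMap.id ℝ E3 + u.D x) y‖ := by
    intro x y
    have hd := (u.hasFDerivAt_id_add x).hasLineDerivAt y
    have h1 := hd.tendsto_slope_zero
    have h2 := (h1.norm.const_mul M)
    refine ge_of_tendsto h2 ?_
    filter_upwards [self_mem_nhdsWithin] with t ht
    have ht' : t ≠ 0 := ht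
    have h3 := h (x + t • y) x
    rw [add_sub_cancel_left, norm_smul] at h3
    rw [norm_smul, norm_inv]
    have ht2 : 0 < ‖t‖ := norm_pos_iff.2 ht'
    rw [mul_left_comm, inv_mul_eq_div, le_div_iff₀ ht2, mul_comm]
    exact h3
  have hequiv : ∀ x : E3, ∃ e : E3 ≃L[ℝ] E3, (e : E3 →L[ℝ] E3) = ContinuousLinearMap.id ℝ E3 + u.D x := by
    intro x
    have hinj : Function.Injective (ContinuousLinearMap.id ℝ E3 + u.D x) := by
      rw [injective_iff_map_eq_zero]
      intro y hy
      have := hder x y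
      rw [hy, norm_zero, mul_zero] at this
      exact norm_le_zero_iff.1 this
    refine ⟨(LinearEquiv.ofInjectiveEndo
      ((ContinuousLinearMap.id ℝ E3 + u.D x : E3 →L[ℝ] E3) : E3 →ₗ[ℝ] E3) hinj).toContinuousLinearEquiv, ?_⟩
    ext1 y
    rfl
  choose e he using hequiv
  have hder' : ∀ x, HasFDerivAt g (e x : E3 →L[ℝ] E3) x := fun x => by
    rw [he]; exact u.hasFDerivAt_id_add x
  have hopen : IsOpenMap g := by
    rw [isOpenMap_iff_nhds_le]
    intro x
    have hs : HasStrictFDerivAt g (e x : E3 →L[ℝ] E3) x :=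
      hcg.contDiffAt.hasStrictFDerivAt' (hder' x) (by norm_num)
    exact hs.map_nhds_eq_of_equiv.ge
  have hclosed : IsClosed (range g) := 
    hanti.isClosed_range (by
      have := (YC.contDiff u).continuous
      have : LipschitzWith (1 + ‖u‖₊) g := by
        apply LipschitzWith.of_dist_le_mul
        intro x y
        rw [dist_eq_norm, dist_eq_norm]
        have h1 := u.lip x y
        have h2 : g x - g y = (x - y) + (u.f x - u.f y) := by simp only [hg]; abel
        rw [h2]
        refine (norm_add_le _ _).trans ?_
        rw [NNReal.coe_add, NNReal.coe_one, coe_nnnorm]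
        linarith
      exact this.uniformContinuous)
  have hsurj : Function.Surjective g := by
    rw [← range_eq_univ]
    exact IsClopen.eq_univ ⟨hclosed, hopen.isOpen_range⟩ (range_nonempty g)
  have hinj : Function.Injective g := hanti.injective
  let H : E3 ≃ₜ E3 := (Equiv.ofBijective g ⟨hinj, hsurj⟩).toHomeomorphOfContinuousOpen hcg.continuous hopen
  have hH : ∀ x, H x = g x := fun x => rfl
  have hgψ : ∀ y, g (H.symm y) = y := fun y => H.apply_symm_apply y
  refine ⟨H.symm, fun x => H.symm_apply_apply x, hgψ, ?_⟩
  have hcs : ContDiff ℝ 1 H.symm := H.contDiff_symm (f₀' := e) (fun x => hder' x) hcg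
  have hψ : ∀ y, H.symm y - y = - u.f (H.symm y) := fun y => by
    have := hgψ y
    simp only [hg] at this
    nth_rewrite 2 [← this]
    abel
  have hcoc : Tendsto H.symm (cocompact E3) (cocompact E3) := H.symm.isClosedEmbedding.tendsto_cocompact
  have hDψ : ∀ y, HasFDerivAt (fun y => H.symm y - y) (-((u.D (H.symm y)).comp (fderiv ℝ H.symm y))) y := by
    intro y
    have h1 : (fun y => H.symm y - y) = fun y => - u.f (H.symm y) := funext hψ
    rw [h1]
    exact ((u.hasFDerivAt (H.symm y)).comp y (hcs.differentiable (by norm_num) y).hasFDerivAt).neg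
  have hbd : ∀ y, ‖fderiv ℝ H.symm y‖ ≤ M := by
    intro y
    refine norm_fderiv_le_of_lip' ℝ hM (Filter.Eventually.of_forall fun z => ?_)
    have := h (H.symm z) (H.symm y)
    have h1 := hgψ z
    have h2 := hgψ y
    simp only [hg] at h1 h2
    rw [h1, h2] at this
    exact this
  refine ⟨hcs.sub contDiff_id, fun k hk => ?_⟩
  interval_cases k
  · simp only [norm_iteratedFDeriv_zero, hψ, norm_neg]
    exact (tendsto_zero_iff_norm_tendsto_zero.1 (zero_at_infty u.f)).comp hcoc
  · simp only [norm_iteratedFDeriv_one]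
    have h1 := ((tendsto_zero_iff_norm_tendsto_zero.1 (zero_at_infty u.D)).comp hcoc).mul_const M
    rw [zero_mul] at h1
    refine squeeze_zero (fun _ => norm_nonneg _) (fun y => ?_) h1
    rw [(hDψ y).fderiv, norm_neg]
    exact (ContinuousLinearMap.opNorm_comp_le _ _).trans
      (mul_le_mul_of_nonneg_left (hbd y) (norm_nonneg _))

theorem yk_exists_diff {u : YC E3} (hu : u ∈ YU) : ∃ φ : DiffId 1, φ.disp = u := by
  obtain ⟨M, hM, h⟩ := hu
  obtain ⟨ψ, h1, h2, h3⟩ := yk_YU_inv hM h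
  have e : (fun x => x + u.f x - x) = u.f := funext fun x => by abel
  refine ⟨⟨fun x => x + u.f x, ψ, h1, h2, by rw [e]; exact u.memC0, h3⟩, ?_⟩
  apply YC.ext'
  intro x
  change x + u.f x - x = u.f x
  abel

open Classical in
/-- The diffeomorphism with displacement `u`. -/
def yk_diffOf (u : YC E3) : DiffId 1 :=
  if h : u ∈ YU then (yk_exists_diff h).choose else (yk_exists_diff (u := 0)
    ⟨1, zero_le_one, fun x y => by
      have : ∀ x, (0 : YC E3).f x = 0 := fun _ => rfl
      rw [this, this]; simp⟩).choose

theorem yk_diffOf_disp {u : YC E3} (hu : u ∈ YU) : (yk_diffOf u).disp = u := by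
  unfold yk_diffOf
  rw [dif_pos hu]
  exact (yk_exists_diff hu).choose_spec

theorem yk_diffOf_of_disp (φ : DiffId 1) : yk_diffOf φ.disp = φ :=
  DiffId.ext_disp (yk_diffOf_disp φ.disp_mem)

theorem yk_diffOf_apply {u : YC E3} (hu : u ∈ YU) (x : E3) : yk_diffOf u x = x + u.f x := by
  have := (yk_diffOf u).disp_f x
  rw [yk_diffOf_disp hu] at this
  rw [this]
  abel

end P3sec

section P4sec

theorem yk_deriv_ev {F : Type*} [NormedAddCommGroup F] [NormedSpace ℝ F] {u : ℝ → YC F} {u' : YC F}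
    {s : Set ℝ} {t : ℝ} (h : HasDerivWithinAt u u' s t) (x : E3) :
    HasDerivWithinAt (fun t => (u t).f x) (u'.f x) s t :=
  (YC.ev x).hasFDerivAt.comp_hasDerivWithinAt t h

theorem yk_deriv_evD {F : Type*} [NormedAddCommGroup F] [NormedSpace ℝ F] {u : ℝ → YC F} {u' : YC F}
    {s : Set ℝ} {t : ℝ} (h : HasDerivWithinAt u u' s t) (x : E3) :
    HasDerivWithinAt (fun t => (u t).D x) (u'.D x) s t :=
  ((YC.evD (F := F) x).hasFDerivAt (x := u t)).comp_hasDerivWithinAt t h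

/-- Data of a bounded locally Lipschitz velocity. -/
structure YkVel (R : ℝ) (W : YC E3 → YC E3) (W2 : YC E3 → YC (E3 →L[ℝ] E3)) : Prop where
  hR : 0 ≤ R
  hD : ∀ u x, (W2 u).f x = (W u).D x
  bW : ∀ u, ‖W u‖ ≤ R
  bW2 : ∀ u, ‖W2 u‖ ≤ R
  lip : ∀ u ∈ YU, ∃ r > 0, ∃ K ≥ 0, ∀ w ∈ YU, ∀ w' ∈ YU, ‖w - u‖ ≤ r → ‖w' - u‖ ≤ r →
    ‖W w - W w'‖ ≤ K * ‖w - w'‖ ∧ ‖W2 w - W2 w'‖ ≤ K * ‖w - w'‖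

variable {R : ℝ} {W : YC E3 → YC E3} {W2 : YC E3 → YC (E3 →L[ℝ] E3)}

/-- The vector field in displacement space. -/
def ykF (W : YC E3 → YC E3) : ℝ → YC E3 → YC E3 := fun _ u => YC.comp (W u) u

theorem YkVel.Dlip (h : YkVel R W W2) (u : YC E3) (x y : E3) :
    ‖(W u).D x - (W u).D y‖ ≤ R * ‖x - y‖ := by
  rw [← h.hD, ← h.hD]
  exact ((W2 u).lip x y).trans (mul_le_mul_of_nonneg_right (h.bW2 u) (norm_nonneg _))

theorem YkVel.ykLip (h : YkVel R W W2) (T : ℝ) : YkLip YU (ykF W) T := by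
  intro u hu
  obtain ⟨r1, hr1, h1⟩ := yk_YU_ball hu
  obtain ⟨r2, hr2, K, hK, h2⟩ := h.lip u hu
  have hR := h.hR
  refine ⟨min r1 r2, lt_min hr1 hr2, ⟨(K + R) * (1 + (‖u‖ + r2)) + R, by positivity⟩, ?_, ?_⟩
  · intro w hw
    rw [mem_closedBall_iff_norm] at hw
    exact h1 w (hw.trans (min_le_left _ _))
  · intro t _
    apply LipschitzOnWith.of_dist_le_mul
    intro w hw w' hw'
    rw [mem_closedBall_iff_norm] at hw hw'
    rw [dist_eq_norm, dist_eq_norm]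
    change _ ≤ ((K + R) * (1 + (‖u‖ + r2)) + R) * _
    have hwU := h1 w (hw.trans (min_le_left _ _))
    have hwU' := h1 w' (hw'.trans (min_le_left _ _))
    obtain ⟨l1, -⟩ := h2 w hwU w' hwU' (hw.trans (min_le_right _ _)) (hw'.trans (min_le_right _ _))
    have hn : ‖w‖ ≤ ‖u‖ + r2 := by
      have := norm_le_norm_add_norm_sub' w u
      linarith [hw.trans (min_le_right r1 r2)]
    have e : ykF W t w - ykF W t w' =
        YC.comp (W w - W w') w + (YC.comp (W w') w - YC.comp (W w') w') := by
      rw [← YC.comp_sub_left]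
      simp only [ykF]
      abel
    rw [e]
    have a1 := YC.norm_comp_le (W w - W w') w
    have a2 := YC.norm_comp_sub_le (W w') w w' (δ := R * ‖w - w'‖) (by positivity) (by
      intro x
      refine (h.Dlip _ _ _).trans (mul_le_mul_of_nonneg_left ?_ hR)
      rw [add_sub_add_left_eq_sub]
      exact (w - w').norm_f x)
    have a3 : ‖W w - W w'‖ * (1 + ‖w‖) ≤ (K * ‖w - w'‖) * (1 + (‖u‖ + r2)) :=
      mul_le_mul l1 (by linarith) (by positivity) (by positivity)
    have a4 : R * ‖w - w'‖ * (1 + ‖w‖) ≤ R * ‖w - w'‖ * (1 + (‖u‖ + r2)) :=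
      mul_le_mul_of_nonneg_left (by linarith) (by positivity)
    have a5 : ‖W w'‖ * ‖w - w'‖ ≤ R * ‖w - w'‖ := mul_le_mul_of_nonneg_right (h.bW _) (norm_nonneg _)
    refine (norm_add_le _ _).trans ?_
    linarith

theorem YkVel.grow (h : YkVel R W W2) (t : ℝ) (u : YC E3) : ‖ykF W t u‖ ≤ R + R * ‖u‖ := by
  have h1 := YC.norm_comp_le (W u) u
  have h2 : ‖W u‖ * (1 + ‖u‖) ≤ R * (1 + ‖u‖) := mul_le_mul_of_nonneg_right (h.bW u) (by positivity)
  calc _ ≤ _ := h1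
    _ ≤ _ := h2
    _ = _ := by ring

theorem YkVel.back (h : YkVel R W W2) {u : ℝ → YC E3} {t : ℝ} (ht : 0 ≤ t) (h0 : u 0 = 0)
    (hs : YkSol YU (ykF W) u t) (x z : E3) :
    ‖x - z‖ ≤ Real.exp (R * t) * ‖(x + (u t).f x) - (z + (u t).f z)‖ := by
  set d : ℝ → E3 := fun s => (x + (u s).f x) - (z + (u s).f z) with hd
  have hder : ∀ s ∈ Icc 0 t, HasDerivWithinAt d
      ((W (u s)).f (x + (u s).f x) - (W (u s)).f (z + (u s).f z)) (Icc 0 t) s := by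
    intro s hs'
    have h1 := yk_deriv_ev (hs s hs').2 x
    have h2 := yk_deriv_ev (hs s hs').2 z
    exact (h1.const_add x).sub (h2.const_add z)
  set d' : ℝ → E3 := fun s => (W (u s)).f (x + (u s).f x) - (W (u s)).f (z + (u s).f z) with hd'
  have hmaps : MapsTo (fun s => t - s) (Icc 0 t) (Icc 0 t) := fun s hs => ⟨by linarith [hs.2], by linarith [hs.1]⟩
  have hder2 : ∀ s ∈ Icc 0 t, HasDerivWithinAt (fun s => d (t - s)) (- d' (t - s)) (Icc 0 t) s := by
    intro s hs'
    have h1 := (hder (t - s) (hmaps hs')).scomp s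
      ((hasDerivWithinAt_id s (Icc 0 t)).const_sub t) hmaps
    simpa [Function.comp_def, hd'] using h1
  have key := norm_le_gronwallBound_of_norm_deriv_right_le (f := fun s => d (t - s))
    (f' := fun s => - d' (t - s)) (δ := ‖d t‖) (K := R) (ε := 0) (a := 0) (b := t)
    (fun s hs => (hder2 s hs).continuousWithinAt)
    (fun s hs => (hder2 s ⟨hs.1, hs.2.le⟩).mono_of_mem_nhdsWithin
      (Icc_mem_nhdsGE_of_mem hs)) (by simp) (by
      intro s hs
      rw [norm_neg, add_zero]
      exact ((W (u (t - s))).lip _ _).trans (mul_le_mul_of_nonneg_right (h.bW _) (norm_nonneg _)))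
    t ⟨ht, le_rfl⟩
  rw [gronwallBound_ε0, sub_self, sub_zero] at key
  have e : d 0 = x - z := by
    simp only [hd, h0]
    change (x + 0) - (z + 0) = x - z
    simp
  rw [e] at key
  rw [mul_comm]
  exact key

theorem YkVel.cont (h : YkVel R W W2) {u : ℝ → YC E3} {T : ℝ} (hu : ContinuousOn u (Icc 0 T))
    (hU : ∀ t ∈ Icc 0 T, u t ∈ YU) : ContinuousOn (fun t => W (u t)) (Icc 0 T) ∧
      ContinuousOn (fun t => W2 (u t)) (Icc 0 T) := by
  have key : ∀ t₀ ∈ Icc 0 T, ∃ K : ℝ, ∀ᶠ t in 𝓝[Icc 0 T] t₀,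
      ‖W (u t) - W (u t₀)‖ ≤ K * ‖u t - u t₀‖ ∧ ‖W2 (u t) - W2 (u t₀)‖ ≤ K * ‖u t - u t₀‖ := by
    intro t₀ ht₀
    obtain ⟨r, hr, K, hK, hl⟩ := h.lip _ (hU t₀ ht₀)
    refine ⟨K, ?_⟩
    have h1 := (tendsto_iff_norm_sub_tendsto_zero.1 (hu t₀ ht₀)).eventually_lt_const hr
    filter_upwards [h1, self_mem_nhdsWithin] with t h2 h3
    exact hl _ (hU t h3) _ (hU t₀ ht₀) h2.le (by simpa using hr.le)
  constructor
  · intro t₀ ht₀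
    obtain ⟨K, hK⟩ := key t₀ ht₀
    have h1 := (tendsto_iff_norm_sub_tendsto_zero.1 (hu t₀ ht₀)).const_mul K
    rw [mul_zero] at h1
    refine tendsto_iff_norm_sub_tendsto_zero.2 (squeeze_zero' (.of_forall fun _ => norm_nonneg _) ?_ h1)
    exact hK.mono fun t ht => ht.1
  · intro t₀ ht₀
    obtain ⟨K, hK⟩ := key t₀ ht₀
    have h1 := (tendsto_iff_norm_sub_tendsto_zero.1 (hu t₀ ht₀)).const_mul K
    rw [mul_zero] at h1
    refine tendsto_iff_norm_sub_tendsto_zero.2 (squeeze_zero' (.of_forall fun _ => norm_nonneg _) ?_ h1)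
    exact hK.mono fun t ht => ht.2

theorem yk_zero_mem : (0 : YC E3) ∈ YU := by
  refine ⟨1, zero_le_one, fun x y => ?_⟩
  have : ∀ x, (0 : YC E3).f x = 0 := fun _ => rfl
  rw [this, this]
  simp

theorem YkVel.flow (h : YkVel R W W2) {T : ℝ} (hT : 0 ≤ T) :
    ∃ u : ℝ → YC E3, u 0 = 0 ∧ YkSol YU (ykF W) u T := by
  refine yk_exists hT (h.ykLip T) (fun _ _ => continuousOn_const) h.hR h.hR
    (fun t _ u _ => h.grow t u) yk_zero_mem ?_
  intro τ hτ u y h0 hs hy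
  refine ⟨Real.exp (R * T), (Real.exp_pos _).le, fun x z => ?_⟩
  have hx : Tendsto (fun t => (u t).f x) (𝓝[<] τ) (𝓝 (y.f x)) := ((YC.ev x).continuous.tendsto y).comp hy
  have hz : Tendsto (fun t => (u t).f z) (𝓝[<] τ) (𝓝 (y.f z)) := ((YC.ev z).continuous.tendsto y).comp hy
  have hlim := ((hx.const_add x).sub (hz.const_add z)).norm.const_mul (Real.exp (R * T))
  refine ge_of_tendsto hlim ?_
  filter_upwards [Ioo_mem_nhdsLT hτ.1] with t ht
  refine (h.back ht.1.le h0 (hs t ⟨ht.1.le, ht.2⟩) x z).trans ?_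
  apply mul_le_mul_of_nonneg_right _ (norm_nonneg _)
  apply Real.exp_le_exp.2
  exact mul_le_mul_of_nonneg_left (ht.2.le.trans hτ.2) h.hR

/-- Affine linear systems. -/
theorem yk_affine_lip {X : Type*} [NormedAddCommGroup X] [NormedSpace ℝ X] {T B : ℝ} {b : ℝ → X}
    {L : ℝ → X →L[ℝ] X} (hB : ∀ t ∈ Icc 0 T, ‖L t‖ ≤ B) (hB0 : 0 ≤ B) :
    YkLip univ (fun t N => b t + L t N) T := by
  intro x _
  refine ⟨1, one_pos, ⟨B, hB0⟩, subset_univ _, fun t ht => ?_⟩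
  apply LipschitzOnWith.of_dist_le_mul
  intro y _ z _
  rw [dist_eq_norm, dist_eq_norm, add_sub_add_left_eq_sub, ← map_sub]
  exact ((L t).le_opNorm _).trans (mul_le_mul_of_nonneg_right (hB t ht) (norm_nonneg _))

theorem YkVel.second (h : YkVel R W W2) {T : ℝ} (hT : 0 ≤ T) {u : ℝ → YC E3} (h0 : u 0 = 0)
    (hs : YkSol YU (ykF W) u T) :
    ∃ N : ℝ → YC (E3 →L[ℝ] E3), ContinuousOn N (Icc 0 T) ∧
      ∀ t ∈ Icc 0 T, ∀ x, (N t).f x = (u t).D x := by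
  have hc := hs.cont
  have hc2 := (h.cont hc fun t ht => (hs t ht).1).2
  set b : ℝ → YC (E3 →L[ℝ] E3) := fun t => YC.comp (W2 (u t)) (u t) with hb
  have hbc : ContinuousOn b (Icc 0 T) := fun t ht => YC.tendsto_comp (hc2 t ht) (hc t ht)
  obtain ⟨B, hB⟩ := isCompact_Icc.exists_bound_of_continuousOn hbc
  have hB0 : 0 ≤ B := (norm_nonneg _).trans (hB 0 ⟨le_rfl, hT⟩)
  have hL : ∀ t ∈ Icc 0 T, ‖YC.mulL (b t)‖ ≤ 2 * B := by
    intro t ht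
    refine ContinuousLinearMap.opNorm_le_bound _ (by positivity) fun N => ?_
    rw [YC.mulL_apply]
    refine (YC.norm_mul_le' _ _).trans (mul_le_mul_of_nonneg_right ?_ (norm_nonneg _))
    linarith [hB t ht]
  obtain ⟨N, hN0, hN⟩ := yk_exists (X := YC (E3 →L[ℝ] E3)) (U := univ)
    (F := fun t N => b t + YC.mulL (b t) N) (x₀ := 0) (a := B) (b := 2 * B) hT
    (yk_affine_lip hL (by positivity))
    (fun N _ => hbc.add ((YC.mulL.flip N).continuous.comp_continuousOn hbc)) hB0 (by positivity)
    (fun t ht N _ => (norm_add_le _ _).trans (add_le_add (hB t ht)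
      (((YC.mulL (b t)).le_opNorm N).trans (mul_le_mul_of_nonneg_right (hL t ht) (norm_nonneg _)))))
    (mem_univ _) (fun _ _ _ _ _ _ _ => mem_univ _)
  refine ⟨N, hN.cont, fun t ht x => ?_⟩
  let L : ℝ → (E3 →L[ℝ] E3) →L[ℝ] (E3 →L[ℝ] E3) := fun t =>
    ContinuousLinearMap.compL ℝ E3 E3 E3 ((b t).f x)
  have hL2 : ∀ t ∈ Icc 0 T, ‖L t‖ ≤ B := by
    intro t ht
    refine ContinuousLinearMap.opNorm_le_bound _ hB0 fun M => ?_
    refine (ContinuousLinearMap.opNorm_comp_le _ _).trans (mul_le_mul_of_nonneg_right ?_ (norm_nonneg _))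
    exact ((b t).norm_f x).trans (hB t ht)
  refine yk_unique (X := E3 →L[ℝ] E3) (U := univ) (F := fun t M => (b t).f x + L t M) (T := T) (τ := T)
    (u := fun t => (N t).f x) (w := fun t => (u t).D x)
    (yk_affine_lip hL2 hB0) le_rfl ?_ ?_ ?_ t ht
  · intro s hs'
    exact ⟨mem_univ _, yk_deriv_ev (hN s hs').2 x⟩
  · intro s hs'
    refine ⟨mem_univ _, ?_⟩
    have h1 := yk_deriv_evD (hs s hs').2 x
    have e : (ykF W s (u s)).D x = (b s).f x + L s ((u s).D x) := by
      change ((W (u s)).D (x + (u s).f x)).comp (ContinuousLinearMap.id ℝ E3 + (u s).D x) =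
        (W2 (u s)).f (x + (u s).f x) + ((W2 (u s)).f (x + (u s).f x)).comp ((u s).D x)
      rw [h.hD, ContinuousLinearMap.comp_add, ContinuousLinearMap.comp_id]
    rw [e] at h1
    exact h1
  · rw [hN0, h0]
    rfl

end P4sec

section P5sec

variable {V : Type*} [NormedAddCommGroup V] [InnerProductSpace ℝ V]

theorem yk_vel_exists [CompleteSpace V] {B : V →L[ℝ] V →L[ℝ] ℝ} {ω : ℝ} (hω : 0 < ω)
    (hB : ∀ u, 0 ≤ B u u) (j : V →L[ℝ] ℝ) : ∃ v, IsVel B ω j v := by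
  let I : V →L[ℝ] V →L[ℝ] ℝ := LinearMap.mkContinuous₂ (innerₗ V) 1 (fun x y => by
    rw [one_mul]; exact norm_inner_le_norm x y)
  have hI : ∀ x y, I x y = ⟪x, y⟫ := fun x y => rfl
  have hc : IsCoercive (ω • I + B) := by
    refine ⟨ω, hω, fun u => ?_⟩
    change _ ≤ ω * I u u + B u u
    rw [hI, real_inner_self_eq_norm_sq]
    linarith [hB u]
  refine ⟨hc.continuousLinearEquivOfBilin.symm ((InnerProductSpace.toDual ℝ V).symm j), fun w => ?_⟩
  have h := hc.continuousLinearEquivOfBilin_apply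
    (hc.continuousLinearEquivOfBilin.symm ((InnerProductSpace.toDual ℝ V).symm j)) w
  rw [ContinuousLinearEquiv.apply_symm_apply, InnerProductSpace.toDual_symm_apply] at h
  exact h.symm

theorem yk_vel_diff {B B' : V →L[ℝ] V →L[ℝ] ℝ} {ω : ℝ}
    (hB : ∀ u, 0 ≤ B u u) {j j' : V →L[ℝ] ℝ} {v v' : V} (h : IsVel B ω j v) (h' : IsVel B' ω j' v') :
    ω * ‖v - v'‖ ≤ ‖j - j'‖ + ‖B - B'‖ * ‖v'‖ := by
  have h1 := h (v - v')
  have h2 := h' (v - v')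
  have h3 := hB (v - v')
  have h4 : ⟪v, v - v'⟫ - ⟪v', v - v'⟫ = ‖v - v'‖ ^ 2 := by
    rw [← inner_sub_left, real_inner_self_eq_norm_sq]
  have h5 : B v (v - v') = B (v - v') (v - v') + B v' (v - v') := by
    rw [map_sub B, ContinuousLinearMap.sub_apply]; ring
  have h6 : (j - j') (v - v') ≤ ‖j - j'‖ * ‖v - v'‖ :=
    (Real.le_norm_self _).trans ((j - j').le_opNorm _)
  have h7 : -((B - B') v' (v - v')) ≤ ‖B - B'‖ * ‖v'‖ * ‖v - v'‖ :=
    (neg_le_abs _).trans ((B - B').le_opNorm₂ _ _)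
  rw [ContinuousLinearMap.sub_apply] at h6
  rw [ContinuousLinearMap.sub_apply, ContinuousLinearMap.sub_apply] at h7
  have h8 : (ω * ‖v - v'‖) * ‖v - v'‖ ≤ (‖j - j'‖ + ‖B - B'‖ * ‖v'‖) * ‖v - v'‖ := by
    have : (ω * ‖v - v'‖) * ‖v - v'‖ = ω * ⟪v, v - v'⟫ - ω * ⟪v', v - v'⟫ := by
      rw [← mul_sub, h4]; ring
    linarith
  rcases (norm_nonneg (v - v')).eq_or_lt with h9 | h9
  · rw [← h9, mul_zero]
    positivity
  · exact le_of_mul_le_mul_right h8 h9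

theorem yk_vel_norm {B : V →L[ℝ] V →L[ℝ] ℝ} {ω : ℝ}
    (hB : ∀ u, 0 ≤ B u u) {j : V →L[ℝ] ℝ} {v : V} (h : IsVel B ω j v) : ω * ‖v‖ ≤ ‖j‖ := by
  have := yk_vel_diff hB h (B' := B) (j' := 0) (v' := 0) (fun w => by simp)
  simpa using this

theorem yk_vel_unique {B : V →L[ℝ] V →L[ℝ] ℝ} {ω : ℝ} (hω : 0 < ω)
    (hB : ∀ u, 0 ≤ B u u) {j : V →L[ℝ] ℝ} {v v' : V} (h : IsVel B ω j v) (h' : IsVel B ω j v') :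
    v = v' := by
  have hd : IsVel B ω 0 (v - v') := fun w => by
    have h1 := h w
    have h2 := h' w
    rw [inner_sub_left, map_sub B, sub_apply, zero_apply]
    linarith
  have := yk_vel_norm hB hd
  rw [norm_zero] at this
  have h2 : ‖v - v'‖ ≤ 0 := by
    by_contra hc
    push Not at hc
    have := mul_pos hω hc
    linarith
  exact sub_eq_zero.1 (norm_le_zero_iff.1 h2)

/-- First order embedding. -/
def yk_emb1 (emb : V →ₗ[ℝ] (E3 → E3)) (h : ∀ u : V, MemC0 2 (emb u)) (u : V) : YC E3 :=
  YC.ofMem (emb u) (h u).one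

/-- Derivative embedding. -/
def yk_emb2 (emb : V →ₗ[ℝ] (E3 → E3)) (h : ∀ u : V, MemC0 2 (emb u)) (u : V) : YC (E3 →L[ℝ] E3) :=
  YC.ofMem2 (emb u) (h u)

theorem yk_emb1_sub (emb : V →ₗ[ℝ] (E3 → E3)) (h : ∀ u : V, MemC0 2 (emb u)) (u w : V) :
    yk_emb1 emb h u - yk_emb1 emb h w = yk_emb1 emb h (u - w) := by
  apply YC.ext'
  intro x
  change emb u x - emb w x = emb (u - w) x
  rw [map_sub]
  rfl

theorem yk_emb2_sub (emb : V →ₗ[ℝ] (E3 → E3)) (h : ∀ u : V, MemC0 2 (emb u)) (u w : V) :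
    yk_emb2 emb h u - yk_emb2 emb h w = yk_emb2 emb h (u - w) := by
  apply YC.ext'
  intro x
  have := congrArg (fun z : YC E3 => z.D x) (yk_emb1_sub emb h u w)
  exact this

theorem yk_mkVel (emb : V →ₗ[ℝ] (E3 → E3)) {cV : ℝ} (hcV : 0 < cV)
    (hembC0 : ∀ u : V, MemC0 2 (emb u))
    (hembBound : ∀ u : V, normS 2 (emb u) ≤ cV * ‖u‖)
    {ω : ℝ} (hω : 0 < ω)
    {A : DiffId 1 → V →L[ℝ] V →L[ℝ] ℝ}
    (hApos : ∀ (φ : DiffId 1) (u : V), 0 ≤ A φ u u)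
    (hAlip : ∀ φ₀ : DiffId 1, ∃ r > 0, ∃ ℓ > 0, ∀ φ ψ : DiffId 1,
      distS 1 φ φ₀ ≤ r → distS 1 ψ φ₀ ≤ r → ‖A φ - A ψ‖ ≤ ℓ * distS 1 φ ψ)
    {j : DiffId 1 → V →L[ℝ] ℝ}
    (hjlip : ∀ φ₀ : DiffId 1, ∃ r > 0, ∃ ℓ > 0, ∀ φ ψ : DiffId 1,
      distS 1 φ φ₀ ≤ r → distS 1 ψ φ₀ ≤ r → ‖j φ - j ψ‖ ≤ ℓ * distS 1 φ ψ)
    (hjbdd : ∃ C : ℝ, ∀ φ : DiffId 1, ‖j φ‖ ≤ C)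
    {vel : DiffId 1 → V} (hvel : ∀ φ, IsVel (A φ) ω (j φ) (vel φ)) :
    ∃ R, YkVel R (fun u => yk_emb1 emb hembC0 (vel (yk_diffOf u)))
      (fun u => yk_emb2 emb hembC0 (vel (yk_diffOf u))) := by
  obtain ⟨C, hC⟩ := hjbdd
  have hC0 : 0 ≤ C := (norm_nonneg _).trans (hC (yk_diffOf 0))
  have hv : ∀ φ, ‖vel φ‖ ≤ C / ω := fun φ => by
    rw [le_div_iff₀ hω, mul_comm]
    exact (yk_vel_norm (hApos φ) (hvel φ)).trans (hC φ)
  have e1 : ∀ u, ‖yk_emb1 emb hembC0 u‖ ≤ cV * ‖u‖ := fun u =>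
    (YC.ofMem_norm_le (hembC0 u)).trans (hembBound u)
  have e2 : ∀ u, ‖yk_emb2 emb hembC0 u‖ ≤ cV * ‖u‖ := fun u =>
    (YC.ofMem2_norm_le (hembC0 u)).trans (hembBound u)
  refine ⟨cV * (C / ω), by positivity, fun u x => rfl,
    fun u => (e1 _).trans (mul_le_mul_of_nonneg_left (hv _) hcV.le),
    fun u => (e2 _).trans (mul_le_mul_of_nonneg_left (hv _) hcV.le), ?_⟩
  intro u hu
  obtain ⟨rA, hrA, lA, hlA, hA⟩ := hAlip (yk_diffOf u)
  obtain ⟨rj, hrj, lj, hlj, hj⟩ := hjlip (yk_diffOf u)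
  refine ⟨min rA rj / 2, by positivity, cV * ((lj + lA * (C / ω)) * 2 / ω), by positivity, ?_⟩
  intro w hw w' hw' hwr hwr'
  have hd : ∀ w ∈ YU, ∀ w' ∈ YU, distS 1 (yk_diffOf w) (yk_diffOf w') ≤ 2 * ‖w - w'‖ := by
    intro w hw w' hw'
    have := yk_distS_le (yk_diffOf w) (yk_diffOf w')
    rwa [yk_diffOf_disp hw, yk_diffOf_disp hw'] at this
  have a1 : distS 1 (yk_diffOf w) (yk_diffOf u) ≤ min rA rj := by linarith [hd w hw u hu]
  have a2 : distS 1 (yk_diffOf w') (yk_diffOf u) ≤ min rA rj := by linarith [hd w' hw' u hu]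
  have b1 := hA _ _ (a1.trans (min_le_left _ _)) (a2.trans (min_le_left _ _))
  have b2 := hj _ _ (a1.trans (min_le_right _ _)) (a2.trans (min_le_right _ _))
  have b3 := yk_vel_diff (hApos _) (hvel (yk_diffOf w)) (hvel (yk_diffOf w'))
  have hdd := hd w hw w' hw'
  have b4 : ‖A (yk_diffOf w) - A (yk_diffOf w')‖ * ‖vel (yk_diffOf w')‖ ≤
      (lA * (2 * ‖w - w'‖)) * (C / ω) :=
    mul_le_mul (b1.trans (mul_le_mul_of_nonneg_left hdd hlA.le)) (hv _) (norm_nonneg _) (by positivity)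
  have b5 := b2.trans (mul_le_mul_of_nonneg_left hdd hlj.le)
  have b6 : ‖vel (yk_diffOf w) - vel (yk_diffOf w')‖ ≤ (lj + lA * (C / ω)) * 2 / ω * ‖w - w'‖ := by
    rw [div_mul_eq_mul_div, le_div_iff₀ hω, mul_comm]
    linarith
  have b7 := mul_le_mul_of_nonneg_left b6 hcV.le
  rw [← mul_assoc] at b7
  constructor
  · simp only [yk_emb1_sub]
    exact (e1 _).trans b7
  · simp only [yk_emb2_sub]
    exact (e2 _).trans b7

variable {R : ℝ} {W : YC E3 → YC E3} {W2 : YC E3 → YC (E3 →L[ℝ] E3)}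

theorem YkVel.field_cont (h : YkVel R W W2) {u : ℝ → YC E3} {T : ℝ} (hu : ContinuousOn u (Icc 0 T))
    (hU : ∀ t ∈ Icc 0 T, u t ∈ YU) : ContinuousOn (fun t => ykF W t (u t)) (Icc 0 T) :=
  fun t ht => YC.tendsto_comp ((h.cont hu hU).1 t ht) (hu t ht)

/-- Integral form of the equation. -/
theorem YkVel.integral (h : YkVel R W W2) {u : ℝ → YC E3} {T : ℝ} (h0 : u 0 = 0)
    (hs : YkSol YU (ykF W) u T) {t : ℝ} (ht : t ∈ Icc 0 T) (x : E3) :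
    IntervalIntegrable (fun s => (ykF W s (u s)).f x) volume 0 t ∧
      (u t).f x = ∫ s in (0:ℝ)..t, (ykF W s (u s)).f x := by
  have hc := h.field_cont hs.cont fun t ht => (hs t ht).1
  have hcx : ContinuousOn (fun s => (ykF W s (u s)).f x) (Icc 0 t) :=
    (YC.ev x).continuous.comp_continuousOn (hc.mono (Icc_subset_Icc_right ht.2))
  have hi : IntervalIntegrable (fun s => (ykF W s (u s)).f x) volume 0 t :=
    hcx.intervalIntegrable_of_Icc ht.1
  refine ⟨hi, ?_⟩
  have hs' := hs.mono ht.2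
  have := intervalIntegral.integral_eq_sub_of_hasDerivAt_of_le ht.1 (f := fun s => (u s).f x)
    (f' := fun s => (ykF W s (u s)).f x)
    (fun s hss => (yk_deriv_ev (hs' s hss).2 x).continuousWithinAt)
    (fun s hss => (yk_deriv_ev (hs' s ⟨hss.1.le, hss.2.le⟩).2 x).hasDerivAt (Icc_mem_nhds hss.1 hss.2)) hi
  rw [this, h0]
  exact (sub_zero _).symm

theorem YkVel.sol_of_integral (h : YkVel R W W2) {u : ℝ → YC E3} {T : ℝ}
    (hu : ContinuousOn u (Icc 0 T)) (hU : ∀ t ∈ Icc 0 T, u t ∈ YU)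
    (hint : ∀ t ∈ Icc 0 T, ∀ x, (u t).f x = ∫ s in (0:ℝ)..t, (ykF W s (u s)).f x) :
    YkSol YU (ykF W) u T := by
  have hc := h.field_cont hu hU
  have hi : ∀ t ∈ Icc 0 T, IntervalIntegrable (fun s => ykF W s (u s)) volume 0 t := fun t ht =>
    (hc.mono (Icc_subset_Icc_right ht.2)).intervalIntegrable_of_Icc ht.1
  have hG : ∀ t ∈ Icc 0 T, u t = ∫ s in (0:ℝ)..t, ykF W s (u s) := by
    intro t ht
    apply YC.ext'
    intro x
    rw [hint t ht x]
    exact (YC.ev (F := E3) x).intervalIntegral_comp_comm (hi t ht)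
  intro t ht
  refine ⟨hU t ht, ?_⟩
  have : Fact (t ∈ Icc 0 T) := ⟨ht⟩
  have hd := intervalIntegral.integral_hasDerivWithinAt_right (hi t ht) (s := Icc 0 T) (t := Icc 0 T)
    (hc.stronglyMeasurableAtFilter_nhdsWithin measurableSet_Icc t) (hc t ht)
  exact hd.congr (fun s hs => hG s hs) (hG t ht)

end P5sec

/-- **Theorem 3.2(i) (parametric yank model: long-time existence and uniqueness).**
If `φ ↦ A_φ` is symmetric, nonnegative, locally Lipschitz, and `φ ↦ j(φ,θ)` is locally
Lipschitz and bounded in `V*`-norm, then the system driven by `j(φ(s),θ)` has a unique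
solution on `[0,T]`, continuous from `[0,T]` into `Diff_id²(ℝ³)`. -/
theorem parametric_yank_existence_uniqueness
    {V : Type*} [NormedAddCommGroup V] [InnerProductSpace ℝ V] [CompleteSpace V]
    [TopologicalSpace.SeparableSpace V]
    (emb : V →ₗ[ℝ] (E3 → E3)) (cV : ℝ) (hcV : 0 < cV)
    (hembC0 : ∀ u : V, MemC0 2 (emb u))
    (hembBound : ∀ u : V, normS 2 (emb u) ≤ cV * ‖u‖)
    (ω : ℝ) (hω : 0 < ω)
    (A : DiffId 1 → V →L[ℝ] V →L[ℝ] ℝ)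
    (hAsymm : ∀ (φ : DiffId 1) (u w : V), A φ u w = A φ w u)
    (hApos : ∀ (φ : DiffId 1) (u : V), 0 ≤ A φ u u)
    (hAlip : ∀ φ₀ : DiffId 1, ∃ r > 0, ∃ ℓ > 0, ∀ φ ψ : DiffId 1,
      distS 1 φ φ₀ ≤ r → distS 1 ψ φ₀ ≤ r → ‖A φ - A ψ‖ ≤ ℓ * distS 1 φ ψ)
    (m : ℕ) (Θ : Set (EuclideanSpace ℝ (Fin m)))
    (jmap : DiffId 1 → EuclideanSpace ℝ (Fin m) → V →L[ℝ] ℝ)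
    (θ : EuclideanSpace ℝ (Fin m)) (hθ : θ ∈ Θ)
    (hjlip : ∀ φ₀ : DiffId 1, ∃ r > 0, ∃ ℓ > 0, ∀ φ ψ : DiffId 1,
      distS 1 φ φ₀ ≤ r → distS 1 ψ φ₀ ≤ r → ‖jmap φ θ - jmap ψ θ‖ ≤ ℓ * distS 1 φ ψ)
    (hjbdd : ∃ C : ℝ, ∀ φ : DiffId 1, ‖jmap φ θ‖ ≤ C)
    (T : ℝ) (hT : 0 < T) :
    ∃ (φ : ℝ → DiffId 1) (v : ℝ → V),
      IsSolutionP emb ω A (fun φ' => jmap φ' θ) T φ v ∧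
      (∀ (φ' : ℝ → DiffId 1) (v' : ℝ → V),
        IsSolutionP emb ω A (fun φ'' => jmap φ'' θ) T φ' v' →
        ∀ t ∈ Icc (0 : ℝ) T, ∀ x : E3, φ' t x = φ t x) ∧
      (∀ t ∈ Icc (0 : ℝ) T, MemC0 2 fun x => φ t x - x) ∧
      ∀ t₀ ∈ Icc (0 : ℝ) T,
        Tendsto (fun t => normS 2 fun x => φ t x - φ t₀ x)
          (𝓝[Icc (0 : ℝ) T] t₀) (𝓝 0) := by
  choose vel hvel using fun φ : DiffId 1 => yk_vel_exists hω (hApos φ) (jmap φ θ)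
  obtain ⟨R, hW⟩ := yk_mkVel emb hcV hembC0 hembBound hω hApos hAlip hjlip hjbdd hvel
  set W : YC E3 → YC E3 := fun u => yk_emb1 emb hembC0 (vel (yk_diffOf u)) with hWdef
  obtain ⟨u, hu0, hs⟩ := hW.flow hT.le
  obtain ⟨N, hNc, hN⟩ := hW.second hT.le hu0 hs
  have hU : ∀ t ∈ Icc 0 T, u t ∈ YU := fun t ht => (hs t ht).1
  have hun : ∀ t₀ ∈ Icc 0 T, Tendsto (fun t => ‖u t - u t₀‖) (𝓝[Icc 0 T] t₀) (𝓝 0) := fun t₀ ht₀ =>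
    tendsto_iff_norm_sub_tendsto_zero.1 (hs.cont t₀ ht₀)
  have hfield : ∀ t ∈ Icc 0 T, ∀ x, emb (vel (yk_diffOf (u t))) (yk_diffOf (u t) x) =
      (ykF W t (u t)).f x := fun t ht x => by
    rw [yk_diffOf_apply (hU t ht)]
    rfl
  refine ⟨fun t => yk_diffOf (u t), fun t => vel (yk_diffOf (u t)), ⟨fun t _ => hvel _, ?_, ?_⟩,
    ?_, ?_, ?_⟩
  · intro t ht x
    obtain ⟨i1, i2⟩ := hW.integral hu0 hs ht x
    have hcongr : EqOn (fun s => (ykF W s (u s)).f x)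
        (fun s => emb (vel (yk_diffOf (u s))) (yk_diffOf (u s) x)) (uIcc 0 t) := by
      intro s hs'
      rw [uIcc_of_le ht.1] at hs'
      exact (hfield s ⟨hs'.1, hs'.2.trans ht.2⟩ x).symm
    refine ⟨i1.congr (hcongr.mono uIoc_subset_uIcc), ?_⟩
    rw [← intervalIntegral.integral_congr hcongr, ← i2]
    exact yk_diffOf_apply (hU t ht) x
  · intro t₀ ht₀
    have h1 := (hun t₀ ht₀).const_mul 2
    rw [mul_zero] at h1
    refine squeeze_zero' (.of_forall fun t => (norm_nonneg _).trans (yk_le_distS _ _)) ?_ h1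
    filter_upwards [self_mem_nhdsWithin] with t ht
    have := yk_distS_le (yk_diffOf (u t)) (yk_diffOf (u t₀))
    rwa [yk_diffOf_disp (hU t ht), yk_diffOf_disp (hU t₀ ht₀)] at this
  · intro φ' v' ⟨s1, s2, s3⟩
    set u' : ℝ → YC E3 := fun t => (φ' t).disp with hu'
    have hc' : ContinuousOn u' (Icc 0 T) := fun t₀ ht₀ =>
      tendsto_iff_norm_sub_tendsto_zero.2
        (squeeze_zero (fun _ => norm_nonneg _) (fun t => yk_le_distS _ _) (s3 t₀ ht₀))
    have hU' : ∀ t ∈ Icc 0 T, u' t ∈ YU := fun t _ => (φ' t).disp_mem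
    have hv' : ∀ t ∈ Icc 0 T, v' t = vel (φ' t) := fun t ht =>
      yk_vel_unique hω (hApos _) (s1 t ht) (hvel _)
    have hadd : ∀ t x, x + (u' t).f x = φ' t x := fun t x => by
      simp only [hu', DiffId.disp_f]
      abel
    have hs' : YkSol YU (ykF W) u' T := by
      refine hW.sol_of_integral hc' hU' fun t ht x => ?_
      have i2 := (s2 t ht x).2
      have hcongr : EqOn (fun s => emb (v' s) (φ' s x)) (fun s => (ykF W s (u' s)).f x) (uIcc 0 t) := by
        intro s hs'
        rw [uIcc_of_le ht.1] at hs'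
        have hsT : s ∈ Icc 0 T := ⟨hs'.1, hs'.2.trans ht.2⟩
        change emb (v' s) (φ' s x) = emb (vel (yk_diffOf (u' s))) (x + (u' s).f x)
        rw [hv' s hsT, hadd, hu', yk_diffOf_of_disp]
      rw [← intervalIntegral.integral_congr hcongr]
      change φ' t x - x = _
      rw [i2]
      abel
    have hu'0 : u' 0 = 0 := by
      apply YC.ext'
      intro x
      change φ' 0 x - x = 0
      rw [(s2 0 ⟨le_rfl, hT.le⟩ x).2, intervalIntegral.integral_same]
      abel
    have heq := yk_unique (hW.ykLip T) le_rfl hs' hs (hu'0.trans hu0.symm)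
    intro t ht x
    change φ' t x = yk_diffOf (u t) x
    rw [yk_diffOf_apply (hU t ht), ← heq t ht, hadd]
  · intro t ht
    have e : (fun x => yk_diffOf (u t) x - x) = (u t).f := funext fun x => by
      rw [yk_diffOf_apply (hU t ht)]
      abel
    change MemC0 2 (fun x => yk_diffOf (u t) x - x)
    rw [e]
    exact YC.memC02 _ (N t) (hN t ht)
  · intro t₀ ht₀
    have h1 := ((hun t₀ ht₀).const_mul 2).add
      (tendsto_iff_norm_sub_tendsto_zero.1 (hNc t₀ ht₀))
    rw [mul_zero, add_zero] at h1
    refine squeeze_zero' (.of_forall fun t => Finset.sum_nonneg fun k _ => yk_supDeriv_nonneg _ _) ?_ h1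
    filter_upwards [self_mem_nhdsWithin] with t ht
    have e : (fun x => yk_diffOf (u t) x - yk_diffOf (u t₀) x) = (u t - u t₀).f := funext fun x => by
      rw [yk_diffOf_apply (hU t ht), yk_diffOf_apply (hU t₀ ht₀), add_sub_add_left_eq_sub]
      rfl
    change normS 2 (fun x => yk_diffOf (u t) x - yk_diffOf (u t₀) x) ≤ _
    rw [e]
    exact YC.normS2_le _ (N t - N t₀) fun x => by
      change (N t).f x - (N t₀).f x = (u t).D x - (u t₀).D x
      rw [hN t ht, hN t₀ ht₀]
end
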